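/- arXiv:0802.2111 — 2 statements merged into one kernel-verified Lean document; each statement's English description precedes it below -/
import Mathlib

section
/- (Slodkowski's theorem, planar form.) Let E ⊆ ℂ be any subset and let h : Δ × E → ℂ be a holomorphic motion of E parametrized by Δ with base point 0. Then there exists a holomorphic motion H : Δ × ℂ → ℂ of the whole complex plane, parametrized by Δ with base point 0, such that H(c, z) = h(c, z) for all (c, z) ∈ Δ × E. -/
/-- `h` is a holomorphic motion of `E ⊆ ℂ` parametrized by the disk `Δ_r = {|c| < r}`
with base point `0`: `h 0 z = z` on `E`; `z ↦ h c z` is injective on `E` for each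
`c ∈ Δ_r`; and `c ↦ h c z` is holomorphic on `Δ_r` for each `z ∈ E`. -/
def IsHolomorphicMotion (r : ℝ) (E : Set ℂ) (h : ℂ → ℂ → ℂ) : Prop :=
  (∀ z ∈ E, h 0 z = z) ∧
  (∀ c ∈ Metric.ball (0 : ℂ) r, Set.InjOn (fun z => h c z) E) ∧
  (∀ z ∈ E, DifferentiableOn ℂ (fun c => h c z) (Metric.ball (0 : ℂ) r))

section

open Set Metric MeasureTheory Filter Topology

/-- A bounded Borel function on the plane. -/
structure IsBoundedMeasurable (φ : ℂ → ℂ) : Prop where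
  measurable : Measurable φ
  bounded : ∃ M, ∀ z, ‖φ z‖ ≤ M

/-- The Cauchy transform over the unit disk, without the usual factor `1 / π`. -/
noncomputable def cauchyTransform (φ : ℂ → ℂ) (z : ℂ) : ℂ :=
  ∫ ζ in ball (0 : ℂ) 1, φ ζ * (z - ζ)⁻¹

namespace IsBoundedMeasurable

variable {φ χ : ℂ → ℂ}

theorem exists_pos_bound (hφ : IsBoundedMeasurable φ) : ∃ M, 0 < M ∧ ∀ z, ‖φ z‖ ≤ M := by
  obtain ⟨M, hM⟩ := hφ.bounded
  exact ⟨max M 1, by positivity, fun z => (hM z).trans (le_max_left _ _)⟩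

theorem const (k : ℂ) : IsBoundedMeasurable fun _ => k :=
  ⟨measurable_const, ‖k‖, fun _ => le_rfl⟩

theorem add (hφ : IsBoundedMeasurable φ) (hχ : IsBoundedMeasurable χ) :
    IsBoundedMeasurable fun z => φ z + χ z := by
  obtain ⟨M, hM⟩ := hφ.bounded
  obtain ⟨N, hN⟩ := hχ.bounded
  exact ⟨hφ.measurable.add hχ.measurable, M + N, fun z => norm_add_le_of_le (hM z) (hN z)⟩

theorem sub (hφ : IsBoundedMeasurable φ) (hχ : IsBoundedMeasurable χ) :
    IsBoundedMeasurable fun z => φ z - χ z := by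
  obtain ⟨M, hM⟩ := hφ.bounded
  obtain ⟨N, hN⟩ := hχ.bounded
  exact ⟨hφ.measurable.sub hχ.measurable, M + N, fun z => norm_sub_le_of_le (hM z) (hN z)⟩

theorem mul (hφ : IsBoundedMeasurable φ) (hχ : IsBoundedMeasurable χ) :
    IsBoundedMeasurable fun z => φ z * χ z := by
  obtain ⟨M, hM⟩ := hφ.bounded
  obtain ⟨N, hN⟩ := hχ.bounded
  exact ⟨hφ.measurable.mul hχ.measurable, M * N, fun z => norm_mul_le_of_le (hM z) (hN z)⟩

theorem pow (hφ : IsBoundedMeasurable φ) (n : ℕ) : IsBoundedMeasurable fun z => φ z ^ n := by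
  induction n with
  | zero => simpa using IsBoundedMeasurable.const 1
  | succ n ih => simpa only [pow_succ] using ih.mul hφ

end IsBoundedMeasurable

theorem locallyIntegrable_complex_inv : LocallyIntegrable fun ζ : ℂ => ζ⁻¹ := by
  refine locallyIntegrable_of_norm_le_rpow (C := 1) (α := 1) ?_ ?_ ?_ ?_
  · simp
  · simp
  · exact ae_of_all _ fun x => by simp [Real.rpow_neg_one]
  · exact measurable_inv.aestronglyMeasurable

theorem integrableOn_ball_norm_inv (r : ℝ) :
    IntegrableOn (fun ζ : ℂ => ‖ζ⁻¹‖) (ball 0 r) :=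
  ((locallyIntegrable_complex_inv.integrableOn_isCompact (isCompact_closedBall 0 r)).mono_set
    ball_subset_closedBall).norm

/-- A bound for the integrals of the Cauchy kernel over the unit disk. -/
noncomputable def cauchyKernelBound : ℝ :=
  (∫ ζ in ball (0 : ℂ) 1, ‖ζ⁻¹‖) + volume.real (ball (0 : ℂ) 1)

theorem cauchyKernelBound_nonneg : 0 ≤ cauchyKernelBound :=
  add_nonneg (integral_nonneg fun _ => norm_nonneg _) measureReal_nonneg

theorem integrableOn_norm_cauchyKernel (z : ℂ) :
    IntegrableOn (fun ζ => ‖(z - ζ)⁻¹‖) (ball (0 : ℂ) 1) ∧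
      ∫ ζ in ball (0 : ℂ) 1, ‖(z - ζ)⁻¹‖ ≤ cauchyKernelBound := by
  set g : ℂ → ℝ := (ball (0 : ℂ) 1).indicator fun ζ => ‖ζ⁻¹‖ with hg
  have hgi : Integrable g := (integrable_indicator_iff measurableSet_ball).2
    (integrableOn_ball_norm_inv 1)
  have hgz : Integrable fun ζ => g (z - ζ) := hgi.comp_sub_left z
  have hg0 : ∀ ζ, 0 ≤ g ζ := fun ζ => indicator_nonneg (fun _ _ => norm_nonneg _) ζ
  have hle : ∀ ζ, ‖(z - ζ)⁻¹‖ ≤ g (z - ζ) + 1 := by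
    intro ζ
    by_cases h : z - ζ ∈ ball (0 : ℂ) 1
    · simp [hg, h]
    · have h1 : 1 ≤ ‖z - ζ‖ := by simpa using h
      rw [norm_inv]
      linarith [inv_le_one_of_one_le₀ h1, hg0 (z - ζ)]
  have hone : IntegrableOn (fun _ : ℂ => (1 : ℝ)) (ball (0 : ℂ) 1) :=
    integrableOn_const measure_ball_lt_top.ne
  have hint : IntegrableOn (fun ζ => g (z - ζ) + 1) (ball (0 : ℂ) 1) := hgz.integrableOn.add hone
  have hk : IntegrableOn (fun ζ => ‖(z - ζ)⁻¹‖) (ball (0 : ℂ) 1) :=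
    hint.mono' (by fun_prop) (ae_of_all _ fun ζ => by simpa using hle ζ)
  refine ⟨hk, (integral_mono hk hint hle).trans ?_⟩
  rw [integral_add hgz.integrableOn hone]
  refine add_le_add ?_ (by simp)
  refine (setIntegral_le_integral hgz (ae_of_all _ fun ζ => hg0 _)).trans ?_
  rw [integral_sub_left_eq_self, hg, integral_indicator measurableSet_ball]

theorem IsBoundedMeasurable.integrable_mul_kernel {φ : ℂ → ℂ} (hφ : IsBoundedMeasurable φ)
    (z : ℂ) : IntegrableOn (fun ζ => φ ζ * (z - ζ)⁻¹) (ball (0 : ℂ) 1) := by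
  obtain ⟨M, hM⟩ := hφ.bounded
  have hm := hφ.measurable
  refine ((integrableOn_norm_cauchyKernel z).1.const_mul M).mono'
    (Measurable.aestronglyMeasurable (by fun_prop)) (ae_of_all _ fun ζ => ?_)
  rw [norm_mul]
  exact mul_le_mul_of_nonneg_right (hM ζ) (norm_nonneg _)

theorem norm_cauchyTransform_le {φ : ℂ → ℂ} {M : ℝ} (hM : ∀ z, ‖φ z‖ ≤ M) (z : ℂ) :
    ‖cauchyTransform φ z‖ ≤ M * cauchyKernelBound := by
  have hM0 : 0 ≤ M := (norm_nonneg _).trans (hM 0)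
  refine (norm_integral_le_of_norm_le ((integrableOn_norm_cauchyKernel z).1.const_mul M)
    (ae_of_all _ fun ζ => ?_)).trans ?_
  · rw [norm_mul]
    exact mul_le_mul_of_nonneg_right (hM ζ) (norm_nonneg _)
  · rw [integral_const_mul]
    exact mul_le_mul_of_nonneg_left (integrableOn_norm_cauchyKernel z).2 hM0

theorem IsBoundedMeasurable.cauchyTransform {φ : ℂ → ℂ} (hφ : IsBoundedMeasurable φ) :
    IsBoundedMeasurable (cauchyTransform φ) := by
  obtain ⟨M, hM⟩ := hφ.bounded
  have hm := hφ.measurable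
  refine ⟨?_, _, norm_cauchyTransform_le hM⟩
  have : StronglyMeasurable (Function.uncurry fun z ζ : ℂ => φ ζ * (z - ζ)⁻¹) :=
    Measurable.stronglyMeasurable (by unfold Function.uncurry; fun_prop)
  exact (this.integral_prod_right (ν := volume.restrict (ball (0 : ℂ) 1))).measurable

section Linear

variable {φ χ : ℂ → ℂ}

theorem cauchyTransform_add (hφ : IsBoundedMeasurable φ) (hχ : IsBoundedMeasurable χ) (z : ℂ) :
    cauchyTransform (fun ζ => φ ζ + χ ζ) z = cauchyTransform φ z + cauchyTransform χ z := by
  simp only [cauchyTransform, add_mul]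
  exact integral_add (hφ.integrable_mul_kernel z) (hχ.integrable_mul_kernel z)

theorem cauchyTransform_sub (hφ : IsBoundedMeasurable φ) (hχ : IsBoundedMeasurable χ) (z : ℂ) :
    cauchyTransform (fun ζ => φ ζ - χ ζ) z = cauchyTransform φ z - cauchyTransform χ z := by
  simp only [cauchyTransform, sub_mul]
  exact integral_sub (hφ.integrable_mul_kernel z) (hχ.integrable_mul_kernel z)

theorem cauchyTransform_const_mul (k : ℂ) (φ : ℂ → ℂ) (z : ℂ) :
    cauchyTransform (fun ζ => k * φ ζ) z = k * cauchyTransform φ z := by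
  simp only [cauchyTransform, mul_assoc]
  exact integral_const_mul k _

end Linear

theorem integrable_cauchyKernel_prod {a b : ℂ → ℂ} (ha : IsBoundedMeasurable a)
    (hb : IsBoundedMeasurable b) (z : ℂ) :
    Integrable (fun p : ℂ × ℂ => a p.1 * (z - p.1)⁻¹ * (b p.2 * (p.1 - p.2)⁻¹))
      ((volume.restrict (ball (0 : ℂ) 1)).prod (volume.restrict (ball (0 : ℂ) 1))) := by
  obtain ⟨M, hM⟩ := ha.bounded
  obtain ⟨N, hN⟩ := hb.bounded
  have hM0 : 0 ≤ M := (norm_nonneg _).trans (hM 0)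
  have hN0 : 0 ≤ N := (norm_nonneg _).trans (hN 0)
  have ham := ha.measurable
  have hbm := hb.measurable
  have hmeas : Measurable fun p : ℂ × ℂ => a p.1 * (z - p.1)⁻¹ * (b p.2 * (p.1 - p.2)⁻¹) := by
    fun_prop
  refine (integrable_prod_iff hmeas.aestronglyMeasurable).2 ⟨ae_of_all _ fun ζ =>
    (hb.integrable_mul_kernel ζ).const_mul (a ζ * (z - ζ)⁻¹), ?_⟩
  have hnorm : StronglyMeasurable fun p : ℂ × ℂ =>
      ‖a p.1 * (z - p.1)⁻¹ * (b p.2 * (p.1 - p.2)⁻¹)‖ := hmeas.norm.stronglyMeasurable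
  refine ((integrableOn_norm_cauchyKernel z).1.const_mul (M * (N * cauchyKernelBound))).mono'
    hnorm.integral_prod_right'.aestronglyMeasurable (ae_of_all _ fun ζ => ?_)
  rw [Real.norm_of_nonneg (integral_nonneg fun _ => norm_nonneg _)]
  simp only [norm_mul (a ζ * _) _]
  rw [integral_const_mul, norm_mul]
  have h1 : ∫ η in ball (0 : ℂ) 1, ‖b η * (ζ - η)⁻¹‖ ≤ N * cauchyKernelBound := by
    have h2 := (integrableOn_norm_cauchyKernel ζ)
    calc _ ≤ ∫ η in ball (0 : ℂ) 1, N * ‖(ζ - η)⁻¹‖ :=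
          integral_mono (hb.integrable_mul_kernel ζ).norm (h2.1.const_mul N) fun η => by
            simp only [norm_mul]
            exact mul_le_mul_of_nonneg_right (hN η) (norm_nonneg _)
      _ ≤ _ := by
          rw [integral_const_mul]
          exact mul_le_mul_of_nonneg_left h2.2 hN0
  calc ‖a ζ‖ * ‖(z - ζ)⁻¹‖ * _ ≤ M * ‖(z - ζ)⁻¹‖ * (N * cauchyKernelBound) := by
        exact mul_le_mul (mul_le_mul_of_nonneg_right (hM ζ) (norm_nonneg _)) h1
          (integral_nonneg fun _ => norm_nonneg _) (by positivity)
    _ = _ := by ring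

/-- The product formula for Cauchy transforms. -/
theorem cauchyTransform_mul_cauchyTransform {a b : ℂ → ℂ} (ha : IsBoundedMeasurable a)
    (hb : IsBoundedMeasurable b) (z : ℂ) :
    cauchyTransform a z * cauchyTransform b z =
      cauchyTransform (fun ζ => a ζ * cauchyTransform b ζ) z +
        cauchyTransform (fun ζ => b ζ * cauchyTransform a ζ) z := by
  have hab := integrable_cauchyKernel_prod ha hb z
  have hba : Integrable (Function.uncurry fun ζ η => b η * (z - η)⁻¹ * (a ζ * (η - ζ)⁻¹))
      ((volume.restrict (ball (0 : ℂ) 1)).prod (volume.restrict (ball (0 : ℂ) 1))) :=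
    (integrable_cauchyKernel_prod hb ha z).swap
  have e2 : cauchyTransform (fun ζ => b ζ * cauchyTransform a ζ) z =
      ∫ ζ in ball (0 : ℂ) 1, ∫ η in ball (0 : ℂ) 1,
        b η * (z - η)⁻¹ * (a ζ * (η - ζ)⁻¹) := by
    rw [integral_integral_swap hba]
    unfold cauchyTransform
    simp only [integral_const_mul]
    refine integral_congr_ae (ae_of_all _ fun ζ => ?_)
    ring
  have e1 : cauchyTransform (fun ζ => a ζ * cauchyTransform b ζ) z =
      ∫ ζ in ball (0 : ℂ) 1, ∫ η in ball (0 : ℂ) 1,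
        a ζ * (z - ζ)⁻¹ * (b η * (ζ - η)⁻¹) := by
    unfold cauchyTransform
    simp only [integral_const_mul]
    refine integral_congr_ae (ae_of_all _ fun ζ => ?_)
    ring
  have e0 : cauchyTransform a z * cauchyTransform b z =
      ∫ ζ in ball (0 : ℂ) 1, ∫ η in ball (0 : ℂ) 1,
        a ζ * (z - ζ)⁻¹ * (b η * (z - η)⁻¹) := by
    unfold cauchyTransform
    simp only [integral_const_mul]
    rw [integral_mul_const]
  have hab' := hab.integral_prod_left
  have hba' := hba.integral_prod_left
  simp only [Function.uncurry] at hba'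
  rw [e0, e1, e2, ← integral_add hab' hba']
  have hne : ∀ w : ℂ, ∀ᵐ ζ ∂volume.restrict (ball (0 : ℂ) 1), ζ ≠ w := fun w =>
    ae_restrict_of_ae (Measure.ae_ne volume w)
  refine integral_congr_ae ?_
  filter_upwards [hab.prod_right_ae, hba.prod_right_ae, hne z] with ζ h1 h2 h3
  simp only [Function.uncurry] at h2
  rw [← integral_add h1 h2]
  refine integral_congr_ae ?_
  filter_upwards [hne z, hne ζ] with η h4 h5
  have := sub_ne_zero.2 h3.symm
  have := sub_ne_zero.2 h4.symm
  have := sub_ne_zero.2 h5.symm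
  have h6 : η - ζ = - (ζ - η) := by ring
  rw [h6]
  field_simp
  ring

theorem cauchyTransform_pow_succ {α : ℂ → ℂ} (hα : IsBoundedMeasurable α) (n : ℕ) (z : ℂ) :
    cauchyTransform α z ^ (n + 1) =
      (n + 1) * cauchyTransform (fun ζ => α ζ * cauchyTransform α ζ ^ n) z := by
  induction n generalizing z with
  | zero => simp
  | succ n ih =>
    have h := cauchyTransform_mul_cauchyTransform hα (hα.mul (hα.cauchyTransform.pow n)) z
    have e1 : (fun ζ => α ζ * cauchyTransform (fun ζ => α ζ * cauchyTransform α ζ ^ n) ζ) =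
        fun ζ => ((n : ℂ) + 1)⁻¹ * (α ζ * cauchyTransform α ζ ^ (n + 1)) := by
      funext ζ
      rw [ih ζ]
      field_simp
    have e2 : (fun ζ => α ζ * cauchyTransform α ζ ^ n * cauchyTransform α ζ) =
        fun ζ => α ζ * cauchyTransform α ζ ^ (n + 1) := by
      funext ζ
      ring
    rw [e1, e2, cauchyTransform_const_mul] at h
    have hn : (n : ℂ) + 1 ≠ 0 := by exact_mod_cast n.succ_ne_zero
    rw [pow_succ, ih z]
    push_cast
    calc _ = ((n : ℂ) + 1) * (cauchyTransform α z *
          cauchyTransform (fun ζ => α ζ * cauchyTransform α ζ ^ n) z) := by ring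
      _ = _ := by
        rw [h]
        field_simp
        ring

/-- The chain rule `F ∘ s = F 0 + P (α * F' ∘ s)` for a Cauchy transform `s = P α`. -/
theorem comp_cauchyTransform {α F : ℂ → ℂ} {R ρ : ℝ} (hα : IsBoundedMeasurable α)
    (hR : ∀ z, ‖cauchyTransform α z‖ ≤ R) (hRρ : R < ρ)
    (hF : DifferentiableOn ℂ F (ball 0 ρ)) (z : ℂ) :
    F (cauchyTransform α z) =
      F 0 + cauchyTransform (fun ζ => α ζ * deriv F (cauchyTransform α ζ)) z := by
  set s := cauchyTransform α with hs
  have hR0 : 0 ≤ R := (norm_nonneg _).trans (hR 0)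
  have hmem : ∀ ζ, s ζ ∈ ball (0 : ℂ) ρ := fun ζ => by simpa using (hR ζ).trans_lt hRρ
  have hF' : DifferentiableOn ℂ (deriv F) (ball 0 ρ) := hF.deriv isOpen_ball
  obtain ⟨M, hM0, hM⟩ := hα.exists_pos_bound
  set d : ℕ → ℂ := fun n => (n.factorial : ℂ)⁻¹ * iteratedDeriv (n + 1) F 0 with hd
  have hsum : ∀ x ∈ ball (0 : ℂ) ρ, HasSum (fun n => d n * x ^ n) (deriv F x) := by
    intro x hx
    have := Complex.hasSum_taylorSeries_on_ball hF' hx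
    simp only [sub_zero, smul_eq_mul] at this
    convert! this using 2 with n
    simp only [hd, iteratedDeriv_succ']
    ring
  have hsumF : HasSum (fun n => (n.factorial : ℂ)⁻¹ * (s z ^ n * iteratedDeriv n F 0)) (F (s z)) := by
    simpa only [sub_zero, smul_eq_mul] using Complex.hasSum_taylorSeries_on_ball hF (hmem z)
  have hsumR : Summable fun n => ‖d n‖ * R ^ n := by
    have := (hsum (R : ℂ) (by simpa [abs_of_nonneg hR0] using hRρ)).summable.norm
    simpa [abs_of_nonneg hR0] using this
  have hterm : ∀ n, IsBoundedMeasurable fun ζ => α ζ * (d n * s ζ ^ n) := fun n =>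
    hα.mul ((IsBoundedMeasurable.const (d n)).mul (hα.cauchyTransform.pow n))
  have hbound : ∀ n ζ, ‖α ζ * (d n * s ζ ^ n) * (z - ζ)⁻¹‖ ≤
      (M * (‖d n‖ * R ^ n)) * ‖(z - ζ)⁻¹‖ := by
    intro n ζ
    rw [norm_mul, norm_mul, norm_mul, norm_pow]
    gcongr
    · exact hM ζ
    · exact hR ζ
  have hI := hasSum_integral_of_summable_integral_norm
    (μ := volume.restrict (ball (0 : ℂ) 1))
    (F := fun n ζ => α ζ * (d n * s ζ ^ n) * (z - ζ)⁻¹)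
    (fun n => (hterm n).integrable_mul_kernel z) (by
      refine Summable.of_nonneg_of_le (fun n => integral_nonneg fun _ => norm_nonneg _) (fun n => ?_)
        ((hsumR.mul_left M).mul_right cauchyKernelBound)
      refine (integral_mono ((hterm n).integrable_mul_kernel z).norm
        ((integrableOn_norm_cauchyKernel z).1.const_mul _) (hbound n)).trans ?_
      rw [integral_const_mul]
      exact mul_le_mul_of_nonneg_left (integrableOn_norm_cauchyKernel z).2 (by positivity))
  have hT : ∫ ζ in ball (0 : ℂ) 1, ∑' n, α ζ * (d n * s ζ ^ n) * (z - ζ)⁻¹ =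
      cauchyTransform (fun ζ => α ζ * deriv F (s ζ)) z := by
    refine integral_congr_ae (ae_of_all _ fun ζ => ?_)
    exact (((hsum (s ζ) (hmem ζ)).mul_left (α ζ)).mul_right _).tsum_eq
  rw [hT] at hI
  have hcoef : ∀ n, ∫ ζ in ball (0 : ℂ) 1, α ζ * (d n * s ζ ^ n) * (z - ζ)⁻¹ =
      ((n + 1).factorial : ℂ)⁻¹ * (s z ^ (n + 1) * iteratedDeriv (n + 1) F 0) := by
    intro n
    have h1 : ∫ ζ in ball (0 : ℂ) 1, α ζ * (d n * s ζ ^ n) * (z - ζ)⁻¹ =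
        cauchyTransform (fun ζ => d n * (α ζ * s ζ ^ n)) z :=
      integral_congr_ae (ae_of_all _ fun ζ => by simp only; ring)
    have hn : (n : ℂ) + 1 ≠ 0 := by exact_mod_cast n.succ_ne_zero
    rw [h1, cauchyTransform_const_mul, cauchyTransform_pow_succ hα, hd, Nat.factorial_succ]
    have : (n.factorial : ℂ) ≠ 0 := by exact_mod_cast n.factorial_ne_zero
    push_cast
    field_simp
    rfl
  simp only [hcoef] at hI
  have h2 := (hasSum_nat_add_iff' 1).2 hsumF
  have h3 := hI.unique h2
  simp only [Finset.sum_range_one, Nat.factorial_zero, pow_zero, iteratedDeriv_zero] at h3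
  rw [h3]
  simp

section IntegralEquation

variable {α v w : ℂ → ℂ} {k : ℂ}

theorem IsBoundedMeasurable.exp_neg (hα : IsBoundedMeasurable α) :
    IsBoundedMeasurable fun z => Complex.exp (-α z) := by
  obtain ⟨M, hM⟩ := hα.bounded
  refine ⟨Complex.measurable_exp.comp hα.measurable.neg, Real.exp M, fun z => ?_⟩
  refine (Complex.norm_exp_le_exp_norm _).trans (Real.exp_le_exp.2 ?_)
  simpa using hM z

theorem exp_neg_cauchyTransform (hα : IsBoundedMeasurable α) (z : ℂ) :
    cauchyTransform (fun ζ => α ζ * Complex.exp (-cauchyTransform α ζ)) z =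
      1 - Complex.exp (-cauchyTransform α z) := by
  obtain ⟨R, hR⟩ := hα.cauchyTransform.bounded
  have hF : Differentiable ℂ fun x : ℂ => Complex.exp (-x) := by fun_prop
  have h := comp_cauchyTransform hα hR (lt_add_one R) hF.differentiableOn z
  have hd : ∀ x : ℂ, deriv (fun x : ℂ => Complex.exp (-x)) x = (-1) * Complex.exp (-x) := by
    intro x
    simpa using (hasDerivAt_neg x).cexp.deriv
  have e : (fun ζ => α ζ * deriv (fun x : ℂ => Complex.exp (-x)) (cauchyTransform α ζ)) =
      fun ζ => (-1) * (α ζ * Complex.exp (-cauchyTransform α ζ)) := by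
    funext ζ
    rw [hd]
    ring
  rw [e, cauchyTransform_const_mul] at h
  simp only [neg_zero, Complex.exp_zero] at h
  rw [h]
  ring

/-- Variation of constants for the equation `v = w + k + P (α * v)`. -/
theorem variation_of_constants (hα : IsBoundedMeasurable α) (hv : IsBoundedMeasurable v)
    (hw : IsBoundedMeasurable w)
    (h : ∀ z, v z = w z + k + cauchyTransform (fun ζ => α ζ * v ζ) z) (z : ℂ) :
    (v z - w z) * Complex.exp (-cauchyTransform α z) =
      k + cauchyTransform (fun ζ => α ζ * (w ζ * Complex.exp (-cauchyTransform α ζ))) z := by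
  set E : ℂ → ℂ := fun z => Complex.exp (-cauchyTransform α z) with hE
  have hEb : IsBoundedMeasurable E := hα.cauchyTransform.exp_neg
  have hEt : ∀ z, cauchyTransform (fun ζ => α ζ * E ζ) z = 1 - E z := exp_neg_cauchyTransform hα
  have hvt : ∀ z, cauchyTransform (fun ζ => α ζ * v ζ) z = v z - w z - k := fun z => by
    rw [h z]
    ring
  have hp := cauchyTransform_mul_cauchyTransform (hα.mul hv) (hα.mul hEb) z
  simp only [hEt, hvt] at hp
  have hb1 : IsBoundedMeasurable fun ζ => α ζ * v ζ * (1 - E ζ) :=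
    (hα.mul hv).mul ((IsBoundedMeasurable.const 1).sub hEb)
  have hb2 : IsBoundedMeasurable fun ζ => α ζ * E ζ * (v ζ - w ζ - k) :=
    (hα.mul hEb).mul ((hv.sub hw).sub (IsBoundedMeasurable.const k))
  have hb3 : IsBoundedMeasurable fun ζ => α ζ * (w ζ * E ζ) := hα.mul (hw.mul hEb)
  have hb4 : IsBoundedMeasurable fun ζ => k * (α ζ * E ζ) :=
    (IsBoundedMeasurable.const k).mul (hα.mul hEb)
  rw [← cauchyTransform_add hb1 hb2] at hp
  have e : (fun ζ => α ζ * v ζ * (1 - E ζ) + α ζ * E ζ * (v ζ - w ζ - k)) =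
      fun ζ => (α ζ * v ζ - α ζ * (w ζ * E ζ)) - k * (α ζ * E ζ) := by
    funext ζ
    ring
  rw [e, cauchyTransform_sub ((hα.mul hv).sub hb3) hb4, cauchyTransform_sub (hα.mul hv) hb3,
    cauchyTransform_const_mul, hEt, hvt] at hp
  linear_combination -hp

/-- The similarity principle: solutions of `v = k + P (α * v)` are multiples of `exp (P α)`. -/
theorem ne_zero_of_eq_const_add_cauchyTransform (hα : IsBoundedMeasurable α)
    (hv : IsBoundedMeasurable v)
    (h : ∀ z, v z = k + cauchyTransform (fun ζ => α ζ * v ζ) z) {z₀ : ℂ} (h₀ : v z₀ ≠ 0) (z : ℂ) :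
    v z ≠ 0 := by
  have key : ∀ z, v z * Complex.exp (-cauchyTransform α z) = k := by
    intro z
    have := variation_of_constants (w := fun _ => 0) (k := k) hα hv (IsBoundedMeasurable.const 0)
      (fun z => by simpa using h z) z
    simpa [cauchyTransform] using this
  intro hz
  have hk : k = 0 := by rw [← key z, hz, zero_mul]
  have := key z₀
  rw [hk] at this
  exact (mul_ne_zero h₀ (Complex.exp_ne_zero _)) this

/-- An a priori bound for the linear integral equation normalised at `0`. -/
theorem norm_le_of_eq_add_cauchyTransform {M N : ℝ} (hα : IsBoundedMeasurable α)
    (hv : IsBoundedMeasurable v) (hw : IsBoundedMeasurable w) (hM : ∀ z, ‖α z‖ ≤ M)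
    (hN : ∀ z, ‖w z‖ ≤ N)
    (h : ∀ z, v z = w z + (cauchyTransform (fun ζ => α ζ * v ζ) z -
      cauchyTransform (fun ζ => α ζ * v ζ) 0)) (z : ℂ) :
    ‖v z‖ ≤ (1 + 2 * M * cauchyKernelBound * Real.exp (2 * (M * cauchyKernelBound))) * N := by
  set C := cauchyKernelBound
  have hM0 : 0 ≤ M := (norm_nonneg _).trans (hM 0)
  have hN0 : 0 ≤ N := (norm_nonneg _).trans (hN 0)
  set k := -cauchyTransform (fun ζ => α ζ * v ζ) 0
  have key := variation_of_constants (k := k) hα hv hw (fun z => by rw [h z]; ring)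
  have hs : ∀ z, ‖cauchyTransform α z‖ ≤ M * C := norm_cauchyTransform_le hM
  have hE : ∀ z, ‖Complex.exp (-cauchyTransform α z)‖ ≤ Real.exp (M * C) := fun z =>
    (Complex.norm_exp_le_exp_norm _).trans (Real.exp_le_exp.2 (by simpa using hs z))
  have hE' : ∀ z, ‖Complex.exp (cauchyTransform α z)‖ ≤ Real.exp (M * C) := fun z =>
    (Complex.norm_exp_le_exp_norm _).trans (Real.exp_le_exp.2 (hs z))
  set χ : ℂ → ℂ := fun ζ => α ζ * (w ζ * Complex.exp (-cauchyTransform α ζ)) with hχ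
  have hχb : ∀ z, ‖cauchyTransform χ z‖ ≤ M * (N * Real.exp (M * C)) * C := by
    refine norm_cauchyTransform_le fun ζ => ?_
    rw [hχ, norm_mul, norm_mul]
    gcongr
    exacts [hM ζ, hN ζ, hE ζ]
  have hv0 : v 0 - w 0 = 0 := by rw [h 0]; ring
  have hk : k = -cauchyTransform χ 0 := by
    have := key 0
    rw [hv0, zero_mul] at this
    linear_combination -this
  have hvw : v z - w z = (cauchyTransform χ z - cauchyTransform χ 0) *
      Complex.exp (cauchyTransform α z) := by
    have h1 := key z
    rw [hk] at h1
    have h2 : Complex.exp (-cauchyTransform α z) * Complex.exp (cauchyTransform α z) = 1 := by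
      rw [← Complex.exp_add]
      simp
    linear_combination (Complex.exp (cauchyTransform α z)) * h1 - (v z - w z) * h2
  have h3 : ‖v z - w z‖ ≤
      (M * (N * Real.exp (M * C)) * C + M * (N * Real.exp (M * C)) * C) * Real.exp (M * C) := by
    rw [hvw, norm_mul]
    have h4 := norm_sub_le_of_le (hχb z) (hχb 0)
    exact mul_le_mul h4 (hE' z) (norm_nonneg _) ((norm_nonneg _).trans h4)
  have h4 : Real.exp (2 * (M * C)) = Real.exp (M * C) * Real.exp (M * C) := by
    rw [← Real.exp_add]
    ring_nf
  calc ‖v z‖ = ‖w z + (v z - w z)‖ := by ring_nf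
    _ ≤ N + _ := norm_add_le_of_le (hN z) h3
    _ = _ := by
      rw [h4]
      ring

end IntegralEquation

/-- The method of continuity for a Lipschitz perturbation of the identity. -/
theorem surjective_sub_of_apriori_bound {X : Type*} [NormedAddCommGroup X] [NormedSpace ℝ X]
    [CompleteSpace X] {N : X → X} {K C : ℝ} (hN : ∀ u v, ‖N u - N v‖ ≤ K * ‖u - v‖)
    (hC : ∀ t ∈ Icc (0 : ℝ) 1, ∀ u v, ‖u - v‖ ≤ C * ‖(u - t • N u) - (v - t • N v)‖) (w : X) :
    ∃ u, u - N u = w := by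
  obtain ⟨m, hm⟩ := exists_nat_gt (|C| * |K|)
  have hm0 : (0 : ℝ) < m := (by positivity : (0 : ℝ) ≤ |C| * |K|).trans_lt hm
  suffices h : ∀ j : ℕ, j ≤ m → Function.Surjective fun u => u - ((j : ℝ) / m) • N u by
    obtain ⟨u, hu⟩ := h m le_rfl w
    exact ⟨u, by simpa [div_self hm0.ne'] using hu⟩
  intro j
  induction j with
  | zero => exact fun _ w => ⟨w, by simp⟩
  | succ j ih =>
    intro hj w
    have hjm : ((j : ℝ) + 1) ≤ m := by exact_mod_cast hj
    have ht : ((j : ℝ) / m) ∈ Icc (0 : ℝ) 1 :=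
      ⟨by positivity, (div_le_one hm0).2 (by linarith)⟩
    choose S hS using ih (by omega)
    simp only at hS
    have hSl : ∀ x y, ‖S x - S y‖ ≤ |C| * ‖x - y‖ := fun x y => by
      have := hC _ ht (S x) (S y)
      rw [hS, hS] at this
      exact this.trans (mul_le_mul_of_nonneg_right (le_abs_self C) (norm_nonneg _))
    set Φ : X → X := fun u => S (w + (1 / (m : ℝ)) • N u) with hΦ
    have hlip : ContractingWith (|C| * |K| / m).toNNReal Φ := by
      have hq : ((|C| * |K| / m).toNNReal : ℝ) = |C| * |K| / m := Real.coe_toNNReal _ (by positivity)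
      refine ⟨?_, LipschitzWith.of_dist_le_mul fun u v => ?_⟩
      · rw [← NNReal.coe_lt_coe, hq]
        exact (div_lt_one hm0).2 hm
      · rw [dist_eq_norm, dist_eq_norm]
        calc ‖Φ u - Φ v‖ ≤ |C| * ‖(w + (1 / (m : ℝ)) • N u) - (w + (1 / (m : ℝ)) • N v)‖ := hSl _ _
          _ = |C| * (1 / m * ‖N u - N v‖) := by
            rw [add_sub_add_left_eq_sub, ← smul_sub, norm_smul, Real.norm_of_nonneg (by positivity)]
          _ ≤ |C| * (1 / m * (|K| * ‖u - v‖)) := by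
            gcongr
            exact (hN u v).trans (mul_le_mul_of_nonneg_right (le_abs_self K) (norm_nonneg _))
          _ = _ := by
            rw [hq]
            ring
    have : Nonempty X := ⟨0⟩
    have hfix : Φ (hlip.fixedPoint Φ) = hlip.fixedPoint Φ := hlip.fixedPoint_isFixedPt
    set u := hlip.fixedPoint Φ
    refine ⟨u, ?_⟩
    have h1 := hS (w + (1 / (m : ℝ)) • N u)
    change Φ u - _ • N (Φ u) = _ at h1
    rw [hfix] at h1
    simp only
    have h2 : (((j + 1 : ℕ) : ℝ) / m) = (j : ℝ) / m + 1 / m := by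
      push_cast
      ring
    rw [h2, add_smul, ← sub_sub, h1]
    abel

theorem continuous_cauchyTransform {φ : ℂ → ℂ} (hφ : Continuous φ)
    (hsupp : ∀ ζ, 1 ≤ ‖ζ‖ → φ ζ = 0) : Continuous (cauchyTransform φ) := by
  have hcs : HasCompactSupport φ := by
    refine HasCompactSupport.intro (isCompact_closedBall (0 : ℂ) 1) fun ζ hζ => hsupp ζ ?_
    simp only [mem_closedBall, dist_zero_right, not_le] at hζ
    exact hζ.le
  have h := hcs.continuous_convolution_left (ContinuousLinearMap.mul ℝ ℂ) hφ
    locallyIntegrable_complex_inv (μ := volume)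
  convert! h using 1
  funext z
  refine setIntegral_eq_integral_of_forall_compl_eq_zero fun ζ hζ => ?_
  rw [hsupp ζ (by simpa using hζ), zero_mul]

theorem differentiableOn_cauchyTransform {φ : ℂ → ℂ} {r : ℝ} (hφ : IsBoundedMeasurable φ)
    (hr : ∀ ζ ∈ ball (0 : ℂ) r, φ ζ = 0) :
    DifferentiableOn ℂ (cauchyTransform φ) (ball 0 r) := by
  intro z₀ hz₀
  obtain ⟨M, hM0, hM⟩ := hφ.exists_pos_bound
  have hm := hφ.measurable
  set ε := (r - ‖z₀‖) / 2
  have hz₀' : ‖z₀‖ < r := by simpa using hz₀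
  have hε : 0 < ε := by simp only [ε]; linarith
  have hfar : ∀ z ∈ ball z₀ ε, ∀ ζ, φ ζ ≠ 0 → ε ≤ ‖z - ζ‖ := by
    intro z hz ζ hζ
    have h1 : r ≤ ‖ζ‖ := by
      by_contra h
      exact hζ (hr ζ (by simpa using h))
    have h2 : ‖z - z₀‖ < ε := by simpa [dist_eq_norm] using hz
    have h3 : ‖ζ‖ ≤ ‖z - ζ‖ + ‖z - z₀‖ + ‖z₀‖ := by
      calc ‖ζ‖ = ‖-(z - ζ) + (z - z₀) + z₀‖ := by congr 1; ring
        _ ≤ _ := by simpa only [norm_neg] using norm_add₃_le (a := -(z - ζ)) (b := z - z₀) (c := z₀)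
    have h4 : r - ‖z₀‖ = 2 * ε := by simp only [ε]; ring
    linarith
  refine (hasDerivAt_integral_of_dominated_loc_of_deriv_le (μ := volume.restrict (ball (0 : ℂ) 1))
    (F := fun z ζ => φ ζ * (z - ζ)⁻¹) (F' := fun z ζ => φ ζ * (-1 / (z - ζ) ^ 2))
    (bound := fun _ => M * (1 / ε ^ 2)) (s := ball z₀ ε) (ball_mem_nhds z₀ hε)
    (Eventually.of_forall fun z => (hφ.integrable_mul_kernel z).aestronglyMeasurable)
    (hφ.integrable_mul_kernel z₀) (Measurable.aestronglyMeasurable (by fun_prop))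
    (ae_of_all _ fun ζ z hz => ?_) ?_
    (ae_of_all _ fun ζ z hz => ?_)).2.differentiableAt.differentiableWithinAt
  · by_cases hζ : φ ζ = 0
    · simp only [hζ, zero_mul, norm_zero]
      positivity
    · have := hfar z hz ζ hζ
      rw [norm_mul, norm_div, norm_neg, norm_one, norm_pow]
      gcongr
      exact hM ζ
  · exact integrableOn_const measure_ball_lt_top.ne
  · by_cases hζ : φ ζ = 0
    · simpa [hζ] using hasDerivAt_const z (0 : ℂ)
    · have hne : z - ζ ≠ 0 := norm_pos_iff.1 (hε.trans_le (hfar z hz ζ hζ))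
      exact (((hasDerivAt_id z).sub_const ζ).inv hne).const_mul (φ ζ)

/-- A right-hand side `g` for the equation `∂u/∂z̄ = g(z, u)`: continuous, bounded, Lipschitz in the
second variable and supported over the unit disk. -/
structure IsAdmissibleRHS (L : ℝ) (g : ℂ → ℂ → ℂ) : Prop where
  continuous : Continuous (Function.uncurry g)
  bounded : ∃ B, ∀ ζ w, ‖g ζ w‖ ≤ B
  lipschitz : ∀ ζ w w', ‖g ζ w - g ζ w'‖ ≤ L * ‖w - w'‖
  support : ∀ ζ, 1 ≤ ‖ζ‖ → ∀ w, g ζ w = 0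

namespace IsAdmissibleRHS

variable {L : ℝ} {g : ℂ → ℂ → ℂ} {u v : ℂ → ℂ}

theorem continuous_comp (hg : IsAdmissibleRHS L g) (hu : Continuous u) :
    Continuous fun ζ => g ζ (u ζ) :=
  hg.continuous.comp (continuous_id.prodMk hu)

theorem isBoundedMeasurable_comp (hg : IsAdmissibleRHS L g) (hu : Continuous u) :
    IsBoundedMeasurable fun ζ => g ζ (u ζ) := by
  obtain ⟨B, hB⟩ := hg.bounded
  exact ⟨(hg.continuous_comp hu).measurable, B, fun ζ => hB _ _⟩

theorem nonneg (hg : IsAdmissibleRHS L g) : 0 ≤ L := by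
  have := (norm_nonneg _).trans (hg.lipschitz 0 1 0)
  simpa using this

theorem exists_quotient (hg : IsAdmissibleRHS L g) (hu : Continuous u) (hv : Continuous v) :
    ∃ α, IsBoundedMeasurable α ∧ (∀ z, ‖α z‖ ≤ L) ∧
      ∀ z, g z (u z) - g z (v z) = α z * (u z - v z) := by
  set α : ℂ → ℂ := fun z => (g z (u z) - g z (v z)) / (u z - v z) with hα
  have hb : ∀ z, ‖α z‖ ≤ L := fun z => by
    rw [hα, norm_div]
    exact div_le_of_le_mul₀ (norm_nonneg _) hg.nonneg (hg.lipschitz _ _ _)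
  refine ⟨α, ⟨?_, L, hb⟩, hb, fun z => ?_⟩
  · exact ((hg.continuous_comp hu).sub (hg.continuous_comp hv)).measurable.div
      (hu.sub hv).measurable
  · by_cases h : u z = v z
    · simp [h]
    · rw [hα, div_mul_cancel₀ _ (sub_ne_zero.2 h)]

/-- The operator `u ↦ P g(·, u) - P g(·, u)(0)` on bounded continuous functions. -/
noncomputable def operator (hg : IsAdmissibleRHS L g) (u : BoundedContinuousFunction ℂ ℂ) :
    BoundedContinuousFunction ℂ ℂ :=
  BoundedContinuousFunction.ofNormedAddCommGroup
    (fun z => cauchyTransform (fun ζ => g ζ (u ζ)) z - cauchyTransform (fun ζ => g ζ (u ζ)) 0)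
    ((continuous_cauchyTransform (hg.continuous_comp u.continuous)
      fun ζ hζ => hg.support ζ hζ _).sub continuous_const)
    (hg.bounded.choose * cauchyKernelBound + hg.bounded.choose * cauchyKernelBound)
    fun z => norm_sub_le_of_le
      (norm_cauchyTransform_le (fun ζ => hg.bounded.choose_spec ζ (u ζ)) z)
      (norm_cauchyTransform_le (fun ζ => hg.bounded.choose_spec ζ (u ζ)) 0)

theorem operator_apply (hg : IsAdmissibleRHS L g) (u : BoundedContinuousFunction ℂ ℂ) (z : ℂ) :
    hg.operator u z =
      cauchyTransform (fun ζ => g ζ (u ζ)) z - cauchyTransform (fun ζ => g ζ (u ζ)) 0 :=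
  rfl

theorem operator_sub_apply (hg : IsAdmissibleRHS L g) (u v : BoundedContinuousFunction ℂ ℂ)
    {α : ℂ → ℂ} (hα : ∀ z, g z (u z) - g z (v z) = α z * (u z - v z)) (z : ℂ) :
    hg.operator u z - hg.operator v z = cauchyTransform (fun ζ => α ζ * (u ζ - v ζ)) z -
      cauchyTransform (fun ζ => α ζ * (u ζ - v ζ)) 0 := by
  simp only [← hα, cauchyTransform_sub (hg.isBoundedMeasurable_comp u.continuous)
    (hg.isBoundedMeasurable_comp v.continuous)]
  rw [operator_apply, operator_apply]
  ring

theorem norm_operator_sub_le (hg : IsAdmissibleRHS L g) (u v : BoundedContinuousFunction ℂ ℂ) :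
    ‖hg.operator u - hg.operator v‖ ≤ 2 * (L * cauchyKernelBound) * ‖u - v‖ := by
  obtain ⟨α, -, hαL, hα⟩ := hg.exists_quotient u.continuous v.continuous
  have hL := hg.nonneg
  have hC := cauchyKernelBound_nonneg
  refine (BoundedContinuousFunction.norm_le (by positivity)).2 fun z => ?_
  have hb : ∀ z, ‖cauchyTransform (fun ζ => α ζ * (u ζ - v ζ)) z‖ ≤
      L * ‖u - v‖ * cauchyKernelBound := norm_cauchyTransform_le fun ζ => by
    rw [norm_mul]
    exact mul_le_mul (hαL ζ) ((u - v).norm_coe_le_norm ζ) (norm_nonneg _) hL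
  rw [BoundedContinuousFunction.sub_apply, hg.operator_sub_apply u v hα]
  refine (norm_sub_le_of_le (hb z) (hb 0)).trans (le_of_eq ?_)
  ring

theorem norm_sub_le (hg : IsAdmissibleRHS L g) {t : ℝ} (ht : t ∈ Icc (0 : ℝ) 1)
    (u v : BoundedContinuousFunction ℂ ℂ) :
    ‖u - v‖ ≤ (1 + 2 * L * cauchyKernelBound * Real.exp (2 * (L * cauchyKernelBound))) *
      ‖(u - t • hg.operator u) - (v - t • hg.operator v)‖ := by
  obtain ⟨α, hαb, hαL, hα⟩ := hg.exists_quotient u.continuous v.continuous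
  have hL := hg.nonneg
  have hC := cauchyKernelBound_nonneg
  set w := (u - t • hg.operator u) - (v - t • hg.operator v) with hw
  have hbm : ∀ f : BoundedContinuousFunction ℂ ℂ, IsBoundedMeasurable f := fun f =>
    ⟨f.continuous.measurable, ‖f‖, f.norm_coe_le_norm⟩
  refine (BoundedContinuousFunction.norm_le (by positivity)).2 fun z => ?_
  refine norm_le_of_eq_add_cauchyTransform (α := fun ζ => t * α ζ)
    ((IsBoundedMeasurable.const _).mul hαb) (hbm (u - v)) (hbm w) (fun z => ?_)
    w.norm_coe_le_norm (fun z => ?_) z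
  · rw [norm_mul, Complex.norm_real, Real.norm_of_nonneg ht.1]
    exact (mul_le_of_le_one_left (norm_nonneg _) ht.2).trans (hαL z)
  · have h1 := hg.operator_sub_apply u v hα z
    have e : (fun ζ => (t : ℂ) * α ζ * (u - v) ζ) = fun ζ => (t : ℂ) * (α ζ * (u ζ - v ζ)) := by
      funext ζ
      simp [mul_assoc]
    rw [e, cauchyTransform_const_mul, cauchyTransform_const_mul, ← mul_sub, ← h1]
    simp only [hw, BoundedContinuousFunction.sub_apply, BoundedContinuousFunction.smul_apply,
      Complex.real_smul]
    ring

theorem existsUnique_solution (hg : IsAdmissibleRHS L g) (z : ℂ) :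
    ∃! u : BoundedContinuousFunction ℂ ℂ,
      u - hg.operator u = BoundedContinuousFunction.const ℂ z := by
  obtain ⟨u, hu⟩ := surjective_sub_of_apriori_bound hg.norm_operator_sub_le
    (fun t ht => hg.norm_sub_le ht) (BoundedContinuousFunction.const ℂ z)
  refine ⟨u, hu, fun v hv => ?_⟩
  have := hg.norm_sub_le (right_mem_Icc.2 zero_le_one) v u
  simp only at hv
  rw [one_smul, one_smul, hu, hv, sub_self, norm_zero, mul_zero] at this
  exact sub_eq_zero.1 (norm_le_zero_iff.1 this)

theorem solution_ne (hg : IsAdmissibleRHS L g) {u v : BoundedContinuousFunction ℂ ℂ} {a b : ℂ}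
    (hu : u - hg.operator u = BoundedContinuousFunction.const ℂ a)
    (hv : v - hg.operator v = BoundedContinuousFunction.const ℂ b) (hab : a ≠ b) (z : ℂ) :
    u z ≠ v z := by
  obtain ⟨α, hαb, -, hα⟩ := hg.exists_quotient u.continuous v.continuous
  have hbm : IsBoundedMeasurable (u - v : BoundedContinuousFunction ℂ ℂ) :=
    ⟨(u - v).continuous.measurable, ‖u - v‖, (u - v).norm_coe_le_norm⟩
  have hu' : ∀ z, u z - hg.operator u z = a := fun z => by
    simpa using congrArg (fun f : BoundedContinuousFunction ℂ ℂ => f z) hu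
  have hv' : ∀ z, v z - hg.operator v z = b := fun z => by
    simpa using congrArg (fun f : BoundedContinuousFunction ℂ ℂ => f z) hv
  have h : ∀ z, (u - v) z = (a - b - cauchyTransform (fun ζ => α ζ * (u ζ - v ζ)) 0) +
      cauchyTransform (fun ζ => α ζ * (u - v) ζ) z := fun z => by
    have := hg.operator_sub_apply u v hα z
    simp only [BoundedContinuousFunction.sub_apply]
    linear_combination hu' z - hv' z + this
  have h0 : (u - v) 0 ≠ 0 := by
    rw [h 0]
    simpa using sub_ne_zero.2 hab
  exact sub_ne_zero.1 (ne_zero_of_eq_const_add_cauchyTransform hαb hbm h h0 z)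

end IsAdmissibleRHS

theorem integral_circleMap_sq_mul_inv {l : ℂ} {s : ℝ} (hs : 0 < s) (hl : ‖l‖ ≠ s) :
    ∫ θ in Ioo (-Real.pi) Real.pi, circleMap 0 s θ ^ 2 * (l - circleMap 0 s θ)⁻¹ =
      if ‖l‖ < s then -(2 * Real.pi) * l else 0 := by
  have hper : Function.Periodic (fun θ => circleMap 0 s θ ^ 2 * (l - circleMap 0 s θ)⁻¹)
      (2 * Real.pi) := fun θ => by simp only [periodic_circleMap 0 s θ]
  have hcircle : ∫ θ in Ioo (-Real.pi) Real.pi, circleMap 0 s θ ^ 2 * (l - circleMap 0 s θ)⁻¹ =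
      Complex.I * ∮ ζ in C(0, s), (ζ - l)⁻¹ • ζ := by
    rw [← integral_Ioc_eq_integral_Ioo,
      ← intervalIntegral.integral_of_le (by linarith [Real.pi_pos])]
    have h := hper.intervalIntegral_add_eq (-Real.pi) 0
    rw [zero_add, show -Real.pi + 2 * Real.pi = Real.pi by ring] at h
    rw [h, circleIntegral, ← intervalIntegral.integral_const_mul]
    refine intervalIntegral.integral_congr fun θ _ => ?_
    simp only [deriv_circleMap, smul_eq_mul]
    rw [← neg_sub, inv_neg]
    linear_combination (-(circleMap 0 s θ ^ 2 * (circleMap 0 s θ - l)⁻¹)) * Complex.I_sq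
  rw [hcircle]
  split_ifs with h
  · rw [DiffContOnCl.circleIntegral_sub_inv_smul (f := fun ζ => ζ)
      differentiable_id.diffContOnCl (by simpa using h)]
    simp only [smul_eq_mul]
    linear_combination (2 * Real.pi * l) * Complex.I_sq
  · have h' : s < ‖l‖ := lt_of_le_of_ne (not_lt.1 h) (Ne.symm hl)
    rw [DiffContOnCl.circleIntegral_eq_zero hs.le, mul_zero]
    refine DifferentiableOn.diffContOnCl fun ζ hζ => ?_
    have hζ' : ‖ζ‖ ≤ s := by
      simpa using closure_ball_subset_closedBall hζ
    have hne : ζ - l ≠ 0 := by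
      rw [sub_ne_zero]
      rintro rfl
      linarith
    exact ((((differentiableAt_id).sub_const l).inv hne).smul
      differentiableAt_id).differentiableWithinAt

theorem exists_radial_cutoff {r R : ℝ} (hr : 0 < r) (hrR : r < R) :
    ∃ a : ℝ → ℝ, Continuous a ∧ (∀ s, 0 ≤ a s) ∧ (∀ s, s ≤ r → a s = 0) ∧
      (∀ s, R ≤ s → a s = 0) ∧ ∫ s in Ioi 0, 2 * Real.pi * (s * a s) = 1 := by
  set b : ℝ → ℝ := fun s => max 0 ((s - r) * (R - s))
  have hb : Continuous b := by fun_prop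
  have hb0 : ∀ s, 0 ≤ b s := fun s => le_max_left _ _
  have hbr : ∀ s, s ≤ r → b s = 0 := fun s hs =>
    max_eq_left (mul_nonpos_of_nonpos_of_nonneg (by linarith) (by linarith))
  have hbR : ∀ s, R ≤ s → b s = 0 := fun s hs =>
    max_eq_left (mul_nonpos_of_nonneg_of_nonpos (by linarith) (by linarith))
  have hpos : 0 < ∫ s in Ioi 0, 2 * Real.pi * (s * b s) := by
    have h : ∫ s in Ioi 0, 2 * Real.pi * (s * b s) = ∫ s in r..R, 2 * Real.pi * (s * b s) := by
      rw [intervalIntegral.integral_of_le hrR.le]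
      refine setIntegral_eq_of_subset_of_forall_sdiff_eq_zero measurableSet_Ioi
        (fun s hs => hr.trans hs.1) fun s hs => ?_
      have : b s = 0 := by
        by_cases h : s ≤ r
        · exact hbr s h
        · exact hbR s (not_lt.1 fun h' => hs.2 ⟨not_le.1 h, h'.le⟩)
      rw [this]
      ring
    rw [h]
    refine intervalIntegral.intervalIntegral_pos_of_pos_on
      (Continuous.intervalIntegrable (by fun_prop) _ _) (fun s hs => ?_) hrR
    have h1 : 0 < b s := lt_max_of_lt_right (mul_pos (sub_pos.2 hs.1) (sub_pos.2 hs.2))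
    have h2 : 0 < s := hr.trans hs.1
    have := Real.pi_pos
    positivity
  set K := ∫ s in Ioi 0, 2 * Real.pi * (s * b s)
  refine ⟨fun s => K⁻¹ * b s, by fun_prop, fun s => by have := hb0 s; positivity,
    fun s hs => by simp [hbr s hs], fun s hs => by simp [hbR s hs], ?_⟩
  rw [← inv_mul_cancel₀ hpos.ne', ← integral_const_mul]
  congr 1
  funext s
  ring

theorem Complex.integrableOn_comp_polarCoord_symm {f : ℂ → ℂ} (hf : Measurable f)
    (hfi : Integrable f) :
    IntegrableOn (fun p : ℝ × ℝ => p.1 • f (Complex.polarCoord.symm p)) polarCoord.target := by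
  have hm : Measurable fun p : ℝ × ℝ => p.1 • f (Complex.polarCoord.symm p) := by
    simp only [Complex.polarCoord_symm_apply]
    fun_prop
  refine ⟨hm.aestronglyMeasurable, ?_⟩
  rw [HasFiniteIntegral]
  refine lt_of_eq_of_lt ?_ hfi.2
  rw [← Complex.lintegral_comp_polarCoord_symm]
  refine setLIntegral_congr_fun polarCoord.open_target.measurableSet fun p hp => ?_
  have hp1 : 0 < p.1 := hp.1
  simp only [enorm_smul, smul_eq_mul, Real.enorm_eq_ofReal hp1.le]

theorem cauchyTransform_radial_mul_sq {R : ℝ} (hR : R < 1) {a : ℝ → ℝ} (ha : Continuous a)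
    (haR : ∀ s, R ≤ s → a s = 0) (hβ : IsBoundedMeasurable fun ζ : ℂ => -(a ‖ζ‖ : ℂ) * ζ ^ 2)
    (l : ℂ) :
    cauchyTransform (fun ζ => -(a ‖ζ‖ : ℂ) * ζ ^ 2) l =
      l * ((∫ s in Ioi 0, if ‖l‖ < s then 2 * Real.pi * (s * a s) else 0 : ℝ) : ℂ) := by
  set f : ℂ → ℂ := fun ζ => -(a ‖ζ‖ : ℂ) * ζ ^ 2 * (l - ζ)⁻¹
  have hf0 : ∀ ζ, ζ ∉ ball (0 : ℂ) 1 → f ζ = 0 := by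
    intro ζ hζ
    have : 1 ≤ ‖ζ‖ := by simpa using hζ
    simp [f, haR ‖ζ‖ (by linarith)]
  have hfm : Measurable f := by fun_prop
  have hfi : Integrable f := by
    have h := hβ.integrable_mul_kernel l
    refine (integrableOn_iff_integrable_of_support_subset ?_).1 h
    intro ζ hζ
    by_contra h
    exact hζ (hf0 ζ h)
  have h1 : cauchyTransform (fun ζ => -(a ‖ζ‖ : ℂ) * ζ ^ 2) l = ∫ ζ, f ζ :=
    setIntegral_eq_integral_of_forall_compl_eq_zero hf0
  have hint := Complex.integrableOn_comp_polarCoord_symm hfm hfi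
  rw [h1, ← Complex.integral_comp_polarCoord_symm]
  change ∫ p in Ioi (0 : ℝ) ×ˢ Ioo (-Real.pi) Real.pi, _ = _
  change IntegrableOn _ (Ioi (0 : ℝ) ×ˢ Ioo (-Real.pi) Real.pi) at hint
  rw [Measure.volume_eq_prod] at hint ⊢
  rw [setIntegral_prod _ hint, ← integral_complex_ofReal, ← integral_const_mul]
  refine integral_congr_ae ?_
  have hne : ∀ᵐ s ∂(volume.restrict (Ioi (0 : ℝ))), s ≠ ‖l‖ :=
    ae_restrict_of_ae (Measure.ae_ne volume _)
  filter_upwards [hne, ae_restrict_mem measurableSet_Ioi] with s hsl hs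
  have hs : 0 < s := hs
  have h2 : ∀ θ : ℝ, s • f (Complex.polarCoord.symm (s, θ)) =
      -(s * a s : ℂ) * (circleMap 0 s θ ^ 2 * (l - circleMap 0 s θ)⁻¹) := by
    intro θ
    have h3 : Complex.polarCoord.symm (s, θ) = circleMap 0 s θ := by
      simp [Complex.polarCoord_symm_apply, circleMap, Complex.exp_mul_I]
    have h4 : ‖circleMap 0 s θ‖ = s := by simp [abs_of_pos hs]
    rw [h3]
    simp only [f, h4, Complex.real_smul]
    ring
  simp only [h2]
  rw [integral_const_mul, integral_circleMap_sq_mul_inv hs (Ne.symm hsl)]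
  split_ifs
  · push_cast
    ring
  · simp

theorem exists_holomorphic_cutoff {r R : ℝ} (hr : 0 < r) (hrR : r < R) (hR : R < 1) :
    ∃ β : ℂ → ℂ, Continuous β ∧ IsBoundedMeasurable β ∧ (∀ ζ ∈ ball (0 : ℂ) r, β ζ = 0) ∧
      (∀ ζ, 1 ≤ ‖ζ‖ → β ζ = 0) ∧ (∀ l ∈ ball (0 : ℂ) r, cauchyTransform β l = l) ∧
      ∀ l, ‖cauchyTransform β l‖ ≤ R := by
  obtain ⟨a, ha, ha0, har, haR, hint⟩ := exists_radial_cutoff hr hrR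
  set β : ℂ → ℂ := fun ζ => -(a ‖ζ‖ : ℂ) * ζ ^ 2 with hβ_def
  have hβc : Continuous β := by fun_prop
  have hβ1 : ∀ ζ, 1 ≤ ‖ζ‖ → β ζ = 0 := fun ζ hζ => by
    simp [hβ_def, haR ‖ζ‖ (by linarith)]
  have hβ : IsBoundedMeasurable β := by
    have hcs : HasCompactSupport β := by
      refine HasCompactSupport.intro (isCompact_closedBall (0 : ℂ) 1) fun ζ hζ => hβ1 ζ ?_
      simp only [mem_closedBall, dist_zero_right, not_le] at hζ
      exact hζ.le
    exact ⟨hβc.measurable, hcs.exists_bound_of_continuous hβc⟩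
  have key := cauchyTransform_radial_mul_sq hR ha haR hβ
  set m : ℝ → ℝ := fun s => 2 * Real.pi * (s * a s)
  have hm : IntegrableOn m (Ioi 0) := by
    by_contra h
    rw [integral_undef h] at hint
    exact zero_ne_one hint
  have hm0 : ∀ s ∈ Ioi (0 : ℝ), 0 ≤ m s := fun s hs => by
    have h1 := ha0 s
    have h2 : 0 < s := hs
    have := Real.pi_pos
    positivity
  refine ⟨β, hβc, hβ, fun ζ hζ => ?_, hβ1, fun l hl => ?_, fun l => ?_⟩
  · simp [hβ_def, har ‖ζ‖ (by simpa using (mem_ball_zero_iff.1 hζ).le)]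
  · have h : ∀ s, (if ‖l‖ < s then m s else 0) = m s := by
      intro s
      split_ifs with h
      · rfl
      · have hl' := mem_ball_zero_iff.1 hl
        simp [m, har s (by linarith)]
    have hk := key l
    simp only [m] at h hint
    simpa only [h, hint, Complex.ofReal_one, mul_one] using hk
  · have h0 : 0 ≤ ∫ s in Ioi 0, if ‖l‖ < s then m s else 0 :=
      setIntegral_nonneg measurableSet_Ioi fun s hs => by
        split_ifs
        · exact hm0 s hs
        · exact le_rfl
    have h1 : ∫ s in Ioi 0, (if ‖l‖ < s then m s else 0) ≤ 1 := by
      rw [← hint]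
      refine setIntegral_mono_on ?_ hm measurableSet_Ioi fun s hs => ?_
      · exact Integrable.indicator (s := Ioi ‖l‖) hm measurableSet_Ioi
      · split_ifs
        · exact le_rfl
        · exact hm0 s hs
    rw [show cauchyTransform β l = _ from key l, norm_mul, Complex.norm_real, Real.norm_of_nonneg h0]
    by_cases hl : R ≤ ‖l‖
    · have h : ∀ s, (if ‖l‖ < s then m s else 0) = 0 := by
        intro s
        split_ifs with h
        · simp [m, haR s (by linarith)]
        · rfl
      rw [integral_congr_ae (ae_of_all _ h), integral_zero, mul_zero]
      linarith
    · calc ‖l‖ * _ ≤ ‖l‖ * 1 := by gcongr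
        _ ≤ R := by linarith

theorem isAdmissibleRHS_sum_bump (F : Finset ℂ) {η f : ℂ → ℂ → ℂ} {δ : ℝ} (hδ : 0 < δ)
    (hη : ∀ i ∈ F, Continuous (η i)) (hηs : ∀ i ∈ F, ∀ ζ, 1 ≤ ‖ζ‖ → η i ζ = 0)
    (hf : ∀ i ∈ F, Continuous (f i)) :
    ∃ L, IsAdmissibleRHS L fun ζ w => ∑ i ∈ F, η i ζ * (max 0 (1 - ‖w - f i ζ‖ / δ) : ℝ) := by
  have hb : ∀ i ∈ F, ∃ B, ∀ ζ, ‖η i ζ‖ ≤ B := fun i hi => by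
    have hcs : HasCompactSupport (η i) := by
      refine HasCompactSupport.intro (isCompact_closedBall (0 : ℂ) 1) fun ζ hζ => hηs i hi ζ ?_
      simp only [mem_closedBall, dist_zero_right, not_le] at hζ
      exact hζ.le
    exact hcs.exists_bound_of_continuous (hη i hi)
  choose! B hB using hb
  refine ⟨∑ i ∈ F, B i * δ⁻¹, ?_, ⟨∑ i ∈ F, B i, fun ζ w => ?_⟩, fun ζ w w' => ?_,
    fun ζ hζ w => ?_⟩
  · refine continuous_finsetSum _ fun i hi => ?_
    have h1 := (hη i hi).comp (continuous_fst (X := ℂ) (Y := ℂ))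
    have h2 := (hf i hi).comp (continuous_fst (X := ℂ) (Y := ℂ))
    refine h1.mul (Complex.continuous_ofReal.comp (continuous_const.max (continuous_const.sub
      ((continuous_snd.sub h2).norm.div_const δ))))
  · refine norm_sum_le_of_le _ fun i hi => ?_
    have h0 : 0 ≤ ‖w - f i ζ‖ / δ := by positivity
    rw [norm_mul, Complex.norm_real, Real.norm_of_nonneg (le_max_left _ _)]
    calc ‖η i ζ‖ * max 0 (1 - ‖w - f i ζ‖ / δ) ≤ B i * 1 := by
          gcongr
          · exact (norm_nonneg _).trans (hB i hi ζ)
          · exact hB i hi ζ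
          · exact max_le zero_le_one (by linarith)
      _ = B i := mul_one _
  · rw [← Finset.sum_sub_distrib, Finset.sum_mul]
    refine norm_sum_le_of_le _ fun i hi => ?_
    rw [← mul_sub, norm_mul, ← Complex.ofReal_sub, Complex.norm_real, Real.norm_eq_abs, mul_assoc]
    gcongr
    · exact (norm_nonneg _).trans (hB i hi ζ)
    · exact hB i hi ζ
    · refine (abs_max_sub_max_le_max _ _ _ _).trans (max_le (by simp; positivity) ?_)
      rw [sub_sub_sub_cancel_left, ← sub_div, abs_div, abs_of_pos hδ, div_eq_inv_mul]
      gcongr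
      refine (abs_norm_sub_norm_le _ _).trans (le_of_eq ?_)
      rw [norm_sub_rev w w']
      congr 1
      ring
  · exact Finset.sum_eq_zero fun i hi => by rw [hηs i hi ζ hζ, zero_mul]

theorem IsHolomorphicMotion.exists_separation {F : Finset ℂ} {h : ℂ → ℂ → ℂ}
    (hmot : IsHolomorphicMotion 1 F h) {R : ℝ} (hR : R < 1) :
    ∃ δ > 0, ∀ i ∈ F, ∀ j ∈ F, i ≠ j → ∀ c ∈ closedBall (0 : ℂ) R, δ ≤ ‖h c i - h c j‖ := by
  have hsub : closedBall (0 : ℂ) R ⊆ ball 0 1 := closedBall_subset_ball hR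
  have key : ∀ p ∈ F.offDiag, ∀ᶠ δ in 𝓝[>] (0 : ℝ),
      ∀ c ∈ closedBall (0 : ℂ) R, δ ≤ ‖h c p.1 - h c p.2‖ := by
    rintro ⟨i, j⟩ hp
    obtain ⟨hi, hj, hij⟩ := Finset.mem_offDiag.1 hp
    have hcont : ContinuousOn (fun c => ‖h c i - h c j‖) (closedBall (0 : ℂ) R) :=
      (((hmot.2.2 i hi).sub (hmot.2.2 j hj)).continuousOn.mono hsub).norm
    have hpos : ∀ c ∈ closedBall (0 : ℂ) R, 0 < ‖h c i - h c j‖ := fun c hc =>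
      norm_pos_iff.2 (sub_ne_zero.2 fun heq => hij (hmot.2.1 c (hsub hc) hi hj heq))
    obtain ⟨m, hm, hmle⟩ := (isCompact_closedBall (0 : ℂ) R).exists_forall_le' hcont hpos
    filter_upwards [Ioo_mem_nhdsGT hm] with δ hδ c hc
    exact hδ.2.le.trans (hmle c hc)
  obtain ⟨δ, hδ, hδpos⟩ :=
    (((Filter.eventually_all_finset _).2 key).and self_mem_nhdsWithin).exists
  exact ⟨δ, hδpos, fun i hi j hj hij => hδ (i, j) (Finset.mem_offDiag.2 ⟨hi, hj, hij⟩)⟩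

theorem IsHolomorphicMotion.exists_extension_finset {F : Finset ℂ} {h : ℂ → ℂ → ℂ}
    (hmot : IsHolomorphicMotion 1 F h) {r : ℝ} (hr : 0 < r) (hr1 : r < 1) :
    ∃ H : ℂ → ℂ → ℂ, IsHolomorphicMotion r univ H ∧
      ∀ c ∈ ball (0 : ℂ) r, ∀ z ∈ F, H c z = h c z := by
  obtain ⟨R, hrR, hR1⟩ := exists_between hr1
  obtain ⟨β, hβc, hβb, hβr, hβ1, hψr, hψR⟩ := exists_holomorphic_cutoff hr hrR hR1
  set ψ := cauchyTransform β with hψ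
  have hψc : Continuous ψ := continuous_cauchyTransform hβc hβ1
  have hψ0 : ψ 0 = 0 := hψr 0 (mem_ball_self hr)
  have hψ_mem : ∀ ζ, ψ ζ ∈ closedBall (0 : ℂ) R := fun ζ => by simpa using hψR ζ
  have hψ_mem' : ∀ ζ, ψ ζ ∈ ball (0 : ℂ) 1 := fun ζ => closedBall_subset_ball hR1 (hψ_mem ζ)
  obtain ⟨δ, hδ, hsep⟩ := hmot.exists_separation hR1
  set f : ℂ → ℂ → ℂ := fun i ζ => h (ψ ζ) i with hf_def
  set η : ℂ → ℂ → ℂ := fun i ζ => β ζ * deriv (fun c => h c i) (ψ ζ) with hη_def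
  have hfc : ∀ i ∈ F, Continuous (f i) := fun i hi =>
    (hmot.2.2 i hi).continuousOn.comp_continuous hψc hψ_mem'
  have hηc : ∀ i ∈ F, Continuous (η i) := fun i hi =>
    hβc.mul (((hmot.2.2 i hi).deriv isOpen_ball).continuousOn.comp_continuous hψc hψ_mem')
  have hηs : ∀ i ∈ F, ∀ ζ, 1 ≤ ‖ζ‖ → η i ζ = 0 := fun i _ ζ hζ => by
    simp [hη_def, hβ1 ζ hζ]
  have hfη : ∀ i ∈ F, ∀ z, f i z = i + cauchyTransform (η i) z := fun i hi z => by
    have := comp_cauchyTransform hβb hψR hR1 (hmot.2.2 i hi) z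
    rwa [hmot.1 i hi] at this
  have hη0 : ∀ i ∈ F, cauchyTransform (η i) 0 = 0 := fun i hi => by
    have := hfη i hi 0
    simp only [hf_def, hψ0, hmot.1 i hi] at this
    simpa using this.symm
  obtain ⟨L, hg⟩ := isAdmissibleRHS_sum_bump F hδ hηc hηs hfc
  set g : ℂ → ℂ → ℂ := fun ζ w => ∑ i ∈ F, η i ζ * (max 0 (1 - ‖w - f i ζ‖ / δ) : ℝ) with hg_def
  have hgf : ∀ i ∈ F, ∀ ζ, g ζ (f i ζ) = η i ζ := fun i hi ζ => by
    simp only [hg_def]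
    rw [Finset.sum_eq_single_of_mem i hi fun j hj hji => ?_]
    · simp
    · have : 1 ≤ ‖f i ζ - f j ζ‖ / δ := by
        rw [one_le_div hδ]
        exact hsep i hi j hj hji.symm _ (hψ_mem ζ)
      rw [max_eq_left (by linarith)]
      simp
  choose u hu huniq using hg.existsUnique_solution
  have hu' : ∀ z c, u z c = z + (cauchyTransform (fun ζ => g ζ (u z ζ)) c -
      cauchyTransform (fun ζ => g ζ (u z ζ)) 0) := fun z c => by
    have := congrArg (fun v : BoundedContinuousFunction ℂ ℂ => v c) (hu z)
    simp only [BoundedContinuousFunction.coe_sub, Pi.sub_apply, hg.operator_apply,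
      BoundedContinuousFunction.const_apply] at this
    linear_combination this
  refine ⟨fun c z => u z c, ⟨fun z _ => ?_, fun c _ z _ w _ hzw => ?_, fun z _ => ?_⟩,
    fun c hc i hi => ?_⟩
  · simpa using hu' z 0
  · by_contra hne
    exact hg.solution_ne (hu z) (hu w) hne c hzw
  · have hd := differentiableOn_cauchyTransform
      (hg.isBoundedMeasurable_comp (u z).continuous) (r := r) fun ζ hζ => by
        simp [hg_def, hη_def, hβr ζ hζ]
    exact ((hd.sub_const _).const_add z).congr fun c _ => hu' z c
  · obtain ⟨M, hM⟩ : ∃ M, ∀ ζ, ‖f i ζ‖ ≤ M := by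
      obtain ⟨M, hM⟩ := (isCompact_closedBall (0 : ℂ) R).exists_bound_of_continuousOn
        ((hmot.2.2 i hi).continuousOn.mono (closedBall_subset_ball hR1))
      exact ⟨M, fun ζ => hM _ (hψ_mem ζ)⟩
    have hv := huniq i (BoundedContinuousFunction.ofNormedAddCommGroup (f i) (hfc i hi) M hM) <| by
      ext z
      simp only [BoundedContinuousFunction.coe_sub, Pi.sub_apply, hg.operator_apply,
        BoundedContinuousFunction.const_apply, BoundedContinuousFunction.coe_ofNormedAddCommGroup,
        hgf i hi]
      rw [hη0 i hi, hfη i hi]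
      ring
    simp only [← hv, BoundedContinuousFunction.coe_ofNormedAddCommGroup, hf_def, hψr c hc]

theorem exists_differentiableOn_log {f : ℂ → ℂ} {ρ : ℝ} (hρ : 0 < ρ)
    (hf : DifferentiableOn ℂ f (ball 0 ρ)) (hf0 : ∀ z ∈ ball (0 : ℂ) ρ, f z ≠ 0) :
    ∃ P : ℂ → ℂ, P 0 = Complex.log (f 0) ∧ DifferentiableOn ℂ P (ball 0 ρ) ∧
      ∀ z ∈ ball (0 : ℂ) ρ, Complex.exp (P z) = f z := by
  obtain ⟨P, hP0, hP⟩ := (((hf.deriv isOpen_ball).div hf hf0).isExactOn_ball).with_val_at 0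
    (Complex.log (f 0))
  refine ⟨P, hP0, fun z hz => (hP z hz).differentiableAt.differentiableWithinAt, fun z hz => ?_⟩
  have hd : ∀ z ∈ ball (0 : ℂ) ρ, HasDerivAt (fun z => f z * Complex.exp (-P z)) 0 z := by
    intro z hz
    have h1 := (hf.differentiableAt (isOpen_ball.mem_nhds hz)).hasDerivAt
    convert! h1.mul (hP z hz).neg.cexp using 1
    simp only [Pi.div_apply]
    field_simp [hf0 z hz]
    ring
  have hc := isOpen_ball.is_const_of_deriv_eq_zero (convex_ball (0 : ℂ) ρ).isPreconnected
    (fun z hz => (hd z hz).differentiableAt.differentiableWithinAt)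
    (fun z hz => (hd z hz).deriv) hz (mem_ball_self hρ)
  have h0 := hf0 0 (mem_ball_self hρ)
  simp only [hP0, Complex.exp_neg, Complex.exp_log h0, mul_inv_cancel₀ h0] at hc
  rw [mul_inv_eq_one₀ (Complex.exp_ne_zero _)] at hc
  exact hc.symm

theorem ball_subset_image_of_norm_deriv_le {g : ℂ → ℂ} {p : ℂ} {t : ℝ} (ht : 0 < t)
    (hg : DifferentiableOn ℂ g (ball p t)) (hp : deriv g p ≠ 0)
    (hb : ∀ z ∈ ball p t, ‖deriv g z‖ ≤ 2 * ‖deriv g p‖) :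
    ball (g p) (‖deriv g p‖ * t / 24) ⊆ g '' ball p t := by
  set M := ‖deriv g p‖
  have hM : 0 < M := norm_pos_iff.2 hp
  have hlip : ∀ z ∈ ball p t, ‖deriv g z - deriv g p‖ ≤ 3 * M / t * ‖z - p‖ := fun z hz => by
    have := Complex.dist_le_div_mul_dist_of_mapsTo_ball (R₂ := 3 * M) (hg.deriv isOpen_ball)
      (fun w hw => by
        rw [mem_closedBall, dist_eq_norm]
        have := norm_sub_le (deriv g w) (deriv g p)
        linarith [hb w hw]) hz
    simpa only [dist_eq_norm] using this
  have hsub : closedBall p (t / 6) ⊆ ball p t := closedBall_subset_ball (by linarith)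
  have hlow : ∀ z ∈ sphere p (t / 6), M * t / 12 ≤ ‖g z - g p‖ := by
    intro z hz
    have hzn : ‖z - p‖ = t / 6 := mem_sphere_iff_norm.1 hz
    have hd : ∀ w ∈ closedBall p (t / 6),
        HasDerivWithinAt (fun w => g w - deriv g p * w) (deriv g w - deriv g p)
          (closedBall p (t / 6)) w := fun w hw => by
      have h1 := (hg.differentiableAt (isOpen_ball.mem_nhds (hsub hw))).hasDerivAt
      have h2 := ((hasDerivAt_id' w).const_mul (deriv g p)).hasDerivWithinAt (s := closedBall p (t / 6))
      rw [mul_one] at h2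
      exact h1.hasDerivWithinAt.sub h2
    have hbd : ∀ w ∈ closedBall p (t / 6), ‖deriv g w - deriv g p‖ ≤ M / 2 := fun w hw => by
      have h1 : ‖w - p‖ ≤ t / 6 := by simpa [dist_eq_norm] using hw
      calc _ ≤ 3 * M / t * ‖w - p‖ := hlip w (hsub hw)
        _ ≤ 3 * M / t * (t / 6) := by gcongr
        _ = M / 2 := by field_simp; norm_num
    have := (convex_closedBall p (t / 6)).norm_image_sub_le_of_norm_hasDerivWithin_le hd hbd
      (mem_closedBall_self (by positivity)) (sphere_subset_closedBall hz)
    rw [hzn] at this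
    have h2 : ‖deriv g p * (z - p)‖ ≤ ‖g z - g p‖ +
        ‖g z - deriv g p * z - (g p - deriv g p * p)‖ := by
      rw [← norm_neg (g z - deriv g p * z - _)]
      refine (congrArg norm ?_).trans_le (norm_add_le _ _)
      ring
    rw [norm_mul, hzn] at h2
    change M * _ ≤ _ at h2
    linarith
  have hne : ∃ᶠ z in 𝓝 p, g z ≠ g p :=
    (((hg.differentiableAt (ball_mem_nhds p ht)).hasDerivAt.eventually_ne hp).frequently).filter_mono
      nhdsWithin_le_nhds
  have := (DifferentiableOn.diffContOnCl_ball hg hsub).ball_subset_image_closedBall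
    (by positivity) hlow hne
  rw [show M * t / 24 = M * t / 12 / 2 by ring]
  exact this.trans (image_mono hsub)

theorem mul_norm_deriv_le_of_unit_ball_not_subset {g : ℂ → ℂ} {a : ℂ} {ρ : ℝ}
    (hg : DifferentiableOn ℂ g (ball a ρ)) (hno : ∀ w, ¬ ball w 1 ⊆ g '' ball a ρ) :
    ρ * ‖deriv g a‖ ≤ 48 := by
  rcases le_or_gt ρ 0 with hρ | hρ
  · nlinarith [norm_nonneg (deriv g a)]
  by_contra! hlt
  have hA : 0 < ‖deriv g a‖ := by
    by_contra! h
    nlinarith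
  obtain ⟨ρ', h1, h2⟩ := exists_between ((div_lt_iff₀ hA).2 hlt)
  have hρ' : 0 < ρ' := (by positivity : (0 : ℝ) < 48 / ‖deriv g a‖).trans h1
  rw [div_lt_iff₀ hA] at h1
  have hsub := closedBall_subset_ball h2 (x := a)
  have hcont : ContinuousOn (fun z => (ρ' - ‖z - a‖) * ‖deriv g z‖) (closedBall a ρ') :=
    (by fun_prop : ContinuousOn (fun z : ℂ => ρ' - ‖z - a‖) (closedBall a ρ')).mul
      ((hg.deriv isOpen_ball).continuousOn.mono hsub).norm
  obtain ⟨p, hp, hmax⟩ := (isCompact_closedBall a ρ').exists_isMaxOn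
    ⟨a, mem_closedBall_self hρ'.le⟩ hcont
  have hmax : ∀ z ∈ closedBall a ρ',
    (ρ' - ‖z - a‖) * ‖deriv g z‖ ≤ (ρ' - ‖p - a‖) * ‖deriv g p‖ := fun z hz => hmax hz
  have hbig : 48 < (ρ' - ‖p - a‖) * ‖deriv g p‖ := by
    have := hmax a (mem_closedBall_self hρ'.le)
    simp only [sub_self, norm_zero, sub_zero] at this
    exact h1.trans_le this
  have ht : 0 < ρ' - ‖p - a‖ := by
    by_contra! h
    nlinarith [norm_nonneg (deriv g p)]
  have hdp : deriv g p ≠ 0 := by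
    intro h
    simp only [h, norm_zero, mul_zero] at hbig
    linarith
  set t := (ρ' - ‖p - a‖) / 2 with ht_def
  have htpos : 0 < t := by positivity
  have hin : ∀ z ∈ ball p t, t ≤ ρ' - ‖z - a‖ := fun z hz => by
    have h3 : ‖z - p‖ < t := by simpa [dist_eq_norm] using hz
    have h4 := norm_sub_le_norm_sub_add_norm_sub z p a
    linarith
  have hin' : ball p t ⊆ closedBall a ρ' := fun z hz => by
    rw [mem_closedBall, dist_eq_norm]
    linarith [hin z hz]
  have hb : ∀ z ∈ ball p t, ‖deriv g z‖ ≤ 2 * ‖deriv g p‖ := fun z hz => by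
    have h3 := hmax z (hin' hz)
    have h4 := mul_le_mul_of_nonneg_right (hin z hz) (norm_nonneg (deriv g z))
    have h5 : t * ‖deriv g z‖ ≤ t * (2 * ‖deriv g p‖) := by
      rw [show t * (2 * ‖deriv g p‖) = (ρ' - ‖p - a‖) * ‖deriv g p‖ by rw [ht_def]; ring]
      exact h4.trans h3
    exact le_of_mul_le_mul_left h5 htpos
  refine hno (g p) (Subset.trans (ball_subset_ball ?_) ((ball_subset_image_of_norm_deriv_le htpos
    (hg.mono (hin'.trans hsub)) hdp hb).trans (image_mono (hin'.trans hsub))))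
  rw [ht_def]
  linarith

theorem norm_sub_le_of_unit_ball_not_subset {g : ℂ → ℂ} {ρ ρ' : ℝ} (hρ' : ρ' < ρ)
    (hg : DifferentiableOn ℂ g (ball 0 ρ)) (hno : ∀ w, ¬ ball w 1 ⊆ g '' ball 0 ρ) {z : ℂ}
    (hz : z ∈ closedBall (0 : ℂ) ρ') : ‖g z - g 0‖ ≤ 48 / (ρ - ρ') * ρ' := by
  have hsub : closedBall (0 : ℂ) ρ' ⊆ ball 0 ρ := closedBall_subset_ball hρ'
  have h0 : 0 ≤ ρ' := nonneg_of_mem_closedBall hz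
  have hpos : 0 < ρ - ρ' := sub_pos.2 hρ'
  have hb : ∀ w ∈ closedBall (0 : ℂ) ρ', ‖deriv g w‖ ≤ 48 / (ρ - ρ') := fun w hw => by
    have hb1 : ball w (ρ - ρ') ⊆ ball 0 ρ := ball_subset_ball' (by
      have := mem_closedBall.1 hw
      linarith)
    rw [le_div_iff₀' hpos]
    exact mul_norm_deriv_le_of_unit_ball_not_subset (hg.mono hb1)
      fun v hv => hno v (hv.trans (image_mono hb1))
  refine ((convex_closedBall (0 : ℂ) ρ').norm_image_sub_le_of_norm_deriv_le
    (fun w hw => hg.differentiableAt (isOpen_ball.mem_nhds (hsub hw))) hb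
    (mem_closedBall_self h0) hz).trans ?_
  gcongr
  simpa using hz

theorem exists_cosh_eq_natCast {y : ℝ} (hy : 0 ≤ y) :
    ∃ v ∈ Icc y (y + 4 / 5), ∃ n : ℕ, Real.cosh (Real.pi * v) = n := by
  have hpi := Real.pi_gt_three
  have hstep : Real.cosh (Real.pi * y) + 1 ≤ Real.cosh (Real.pi * (y + 4 / 5)) := by
    have h1 := Real.one_le_cosh (Real.pi * y)
    have h2 : (2 : ℝ) ≤ Real.cosh (Real.pi * (4 / 5)) := by
      rw [Real.cosh_eq]
      have h3 := Real.quadratic_le_exp_of_nonneg (x := Real.pi * (4 / 5)) (by positivity)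
      have h4 := Real.exp_pos (-(Real.pi * (4 / 5)))
      nlinarith
    have h5 : 0 ≤ Real.sinh (Real.pi * y) * Real.sinh (Real.pi * (4 / 5)) :=
      mul_nonneg (Real.sinh_nonneg_iff.2 (by positivity)) (Real.sinh_nonneg_iff.2 (by positivity))
    rw [mul_add, Real.cosh_add]
    nlinarith
  have hcont : ContinuousOn (fun v => Real.cosh (Real.pi * v)) (Icc y (y + 4 / 5)) :=
    (Real.continuous_cosh.comp (continuous_const_mul Real.pi)).continuousOn
  have hmem : ((⌈Real.cosh (Real.pi * y)⌉₊ : ℕ) : ℝ) ∈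
      Icc (Real.cosh (Real.pi * y)) (Real.cosh (Real.pi * (y + 4 / 5))) :=
    ⟨Nat.le_ceil _, (Nat.ceil_lt_add_one (Real.cosh_pos _).le).le.trans hstep⟩
  obtain ⟨v, hv, hveq⟩ := intermediate_value_Icc (by linarith) hcont hmem
  exact ⟨v, hv, _, hveq⟩

theorem exists_mem_ball_cos_eq_intCast (w : ℂ) :
    ∃ v ∈ ball w 1, ∃ n : ℤ, Complex.cos (Real.pi * v) = n := by
  obtain ⟨v, ⟨hv1, hv2⟩, n, hn⟩ := exists_cosh_eq_natCast (abs_nonneg w.im)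
  obtain ⟨y, hy, hyn⟩ : ∃ y : ℝ, |w.im - y| ≤ 4 / 5 ∧ Real.cosh (Real.pi * y) = n := by
    rcases abs_cases w.im with ⟨h, _⟩ | ⟨h, _⟩
    · exact ⟨v, abs_le.2 ⟨by linarith, by linarith⟩, hn⟩
    · exact ⟨-v, abs_le.2 ⟨by linarith, by linarith⟩, by rw [mul_neg, Real.cosh_neg, hn]⟩
  refine ⟨round w.re + y * Complex.I, ?_, (round w.re).negOnePow * n, ?_⟩
  · rw [mem_ball, dist_comm, Complex.dist_eq, ← sq_lt_one_iff₀ (norm_nonneg _),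
      Complex.sq_norm, Complex.normSq_apply]
    have h1 := abs_sub_round w.re
    have h2 : (w - (round w.re + y * Complex.I)).re = w.re - round w.re := by simp
    have h3 : (w - (round w.re + y * Complex.I)).im = w.im - y := by simp
    rw [h2, h3, ← sq, ← sq, ← sq_abs, ← sq_abs (w.im - y)]
    nlinarith [abs_nonneg (w.re - round w.re), abs_nonneg (w.im - y)]
  · rw [mul_add, Complex.cos_add, ← mul_assoc, ← Complex.ofReal_mul, Complex.cos_mul_I,
      ← Complex.ofReal_cosh, hyn]
    have h1 : Complex.cos (Real.pi * (round w.re : ℤ)) = ((round w.re).negOnePow : ℤ) := by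
      rw [mul_comm]
      exact_mod_cast congrArg Complex.ofReal
        ((Real.cos_int_mul_pi (round w.re)).trans (Int.cast_negOnePow ℝ _).symm)
    have h2 : Complex.sin (Real.pi * (round w.re : ℤ)) = 0 := by
      rw [mul_comm, Complex.sin_int_mul_pi]
    rw [h1, h2]
    push_cast
    ring

theorem schottky {a : ℂ} {ρ ρ' : ℝ} (hρ : 0 < ρ) (hρ' : ρ' < ρ) :
    ∃ M : ℝ, ∀ f : ℂ → ℂ, DifferentiableOn ℂ f (ball 0 ρ) → (∀ z ∈ ball (0 : ℂ) ρ, f z ≠ 0) →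
      (∀ z ∈ ball (0 : ℂ) ρ, f z ≠ 1) → f 0 = a → ∀ z ∈ closedBall (0 : ℂ) ρ', ‖f z‖ ≤ M := by
  set F₀ := Complex.log a / (2 * Real.pi * Complex.I) with hF₀
  set S₀ := Complex.exp (Complex.log (1 - F₀ ^ 2) / 2) with hS₀
  set g₀ := Complex.log (F₀ + S₀ * Complex.I) / (Real.pi * Complex.I) with hg₀
  set K := ‖g₀‖ + 48 / (ρ - ρ') * ρ' with hK
  refine ⟨Real.exp (2 * Real.pi * Real.exp (Real.pi * K)), fun f hf hf0 hf1 hfa z hz => ?_⟩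
  have hpi : (Real.pi : ℂ) ≠ 0 := Complex.ofReal_ne_zero.2 Real.pi_ne_zero
  have h2pi : (2 * Real.pi * Complex.I : ℂ) ≠ 0 := Complex.two_pi_I_ne_zero
  obtain ⟨P, hP0, hPd, hP⟩ := exists_differentiableOn_log hρ hf hf0
  set F : ℂ → ℂ := fun z => P z / (2 * Real.pi * Complex.I) with hF
  have hFd : DifferentiableOn ℂ F (ball 0 ρ) := hPd.div_const _
  have hfF : ∀ z ∈ ball (0 : ℂ) ρ, f z = Complex.exp (2 * Real.pi * Complex.I * F z) :=
    fun z hz => by rw [hF, mul_div_cancel₀ _ h2pi, hP z hz]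
  have hFint : ∀ z ∈ ball (0 : ℂ) ρ, ∀ n : ℤ, F z ≠ n := fun z hz n hn => by
    refine hf1 z hz ?_
    rw [hfF z hz, hn, mul_comm, Complex.exp_int_mul_two_pi_mul_I]
  have hFsq : ∀ z ∈ ball (0 : ℂ) ρ, 1 - F z ^ 2 ≠ 0 := fun z hz h => by
    have h' : (F z - 1) * (F z + 1) = 0 := by linear_combination -h
    rcases mul_eq_zero.1 h' with h | h
    · exact hFint z hz 1 (by simpa using sub_eq_zero.1 h)
    · exact hFint z hz (-1) (by simpa using eq_neg_of_add_eq_zero_left h)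
  obtain ⟨Q, hQ0, hQd, hQ⟩ :=
    exists_differentiableOn_log (f := fun z => 1 - F z ^ 2) hρ ((hFd.pow 2).const_sub 1) hFsq
  set S : ℂ → ℂ := fun z => Complex.exp (Q z / 2) with hS
  have hSd : DifferentiableOn ℂ S (ball 0 ρ) := (hQd.div_const _).cexp
  have hSsq : ∀ z ∈ ball (0 : ℂ) ρ, (F z + S z * Complex.I) * (F z - S z * Complex.I) = 1 :=
    fun z hz => by
      have h1 : S z ^ 2 = 1 - F z ^ 2 := by
        rw [hS, ← Complex.exp_nat_mul, ← hQ z hz]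
        congr 1
        push_cast
        ring
      linear_combination h1 - S z ^ 2 * Complex.I_sq
  obtain ⟨T, hT0, hTd, hT⟩ := exists_differentiableOn_log
    (f := fun z => F z + S z * Complex.I) hρ (hFd.add (hSd.mul_const Complex.I))
    fun z hz => left_ne_zero_of_mul_eq_one (hSsq z hz)
  set g : ℂ → ℂ := fun z => T z / (Real.pi * Complex.I) with hg
  have hgd : DifferentiableOn ℂ g (ball 0 ρ) := hTd.div_const _
  have hcos : ∀ z ∈ ball (0 : ℂ) ρ, Complex.cos (Real.pi * g z) = F z := fun z hz => by
    have h1 : Real.pi * g z * Complex.I = T z := by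
      simp only [hg]
      field_simp
    have h2 : Complex.exp (T z) = F z + S z * Complex.I := hT z hz
    have h3 : (F z + S z * Complex.I)⁻¹ = F z - S z * Complex.I :=
      inv_eq_of_mul_eq_one_right (hSsq z hz)
    rw [Complex.cos, neg_mul, h1, Complex.exp_neg, h2, h3]
    ring
  have hno : ∀ w, ¬ ball w 1 ⊆ g '' ball 0 ρ := fun w hw => by
    obtain ⟨v, hv, n, hn⟩ := exists_mem_ball_cos_eq_intCast w
    obtain ⟨z, hz, rfl⟩ := hw hv
    exact hFint z hz n (by rw [← hcos z hz, hn])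
  have hF0 : F 0 = F₀ := by simp only [hF, hP0, hfa, hF₀]
  have hg0 : g 0 = g₀ := by
    simp only [hg, hT0, hS, hQ0, hF0, hg₀, hS₀]
  have hzρ : z ∈ ball (0 : ℂ) ρ := closedBall_subset_ball hρ' hz
  have hgK : ‖g z‖ ≤ K := by
    have h1 := norm_sub_le_of_unit_ball_not_subset hρ' hgd hno hz
    have h2 := norm_le_norm_add_norm_sub' (g z) (g 0)
    rw [hg0] at h1 h2
    linarith
  have hFK : ‖F z‖ ≤ Real.exp (Real.pi * K) := by
    have hn : ‖Real.pi * g z * Complex.I‖ ≤ Real.pi * K := by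
      rw [norm_mul, norm_mul, Complex.norm_I, mul_one, Complex.norm_real,
        Real.norm_of_nonneg Real.pi_pos.le]
      exact mul_le_mul_of_nonneg_left hgK Real.pi_pos.le
    have h1 := (Complex.norm_exp_le_exp_norm (Real.pi * g z * Complex.I)).trans
      (Real.exp_le_exp.2 hn)
    have h2 := (Complex.norm_exp_le_exp_norm (-(Real.pi * g z) * Complex.I)).trans
      (Real.exp_le_exp.2 (by rwa [neg_mul, norm_neg] : _ ≤ Real.pi * K))
    rw [← hcos z hzρ, Complex.cos, norm_div, Complex.norm_ofNat]
    have h3 := norm_add_le (Complex.exp (Real.pi * g z * Complex.I))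
      (Complex.exp (-(Real.pi * g z) * Complex.I))
    linarith
  rw [hfF z hzρ]
  refine (Complex.norm_exp_le_exp_norm _).trans (Real.exp_le_exp.2 ?_)
  rw [norm_mul, norm_mul, norm_mul, Complex.norm_I, mul_one, Complex.norm_real,
    Real.norm_of_nonneg Real.pi_pos.le, Complex.norm_ofNat]
  gcongr

theorem tendstoUniformlyOn_of_eventually_lipschitz {ι : Type*} {l : Filter ι} [l.NeBot]
    {f : ι → ℂ → ℂ} {G : ℂ → ℂ} {s : Set ℂ} (hs : IsCompact s) {K : ℝ} (hK : 0 ≤ K)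
    (hf : ∀ᶠ i in l, ∀ x ∈ s, ∀ y ∈ s, ‖f i x - f i y‖ ≤ K * ‖x - y‖)
    (hG : ∀ x ∈ s, Tendsto (fun i => f i x) l (𝓝 (G x))) : TendstoUniformlyOn f G l s := by
  have hGK : ∀ x ∈ s, ∀ y ∈ s, ‖G x - G y‖ ≤ K * ‖x - y‖ := fun x hx y hy =>
    le_of_tendsto ((hG x hx).sub (hG y hy)).norm (hf.mono fun i hi => hi x hx y hy)
  rw [Metric.tendstoUniformlyOn_iff]
  intro ε hε
  obtain ⟨t, hts, htf, hcov⟩ := hs.finite_cover_balls (e := ε / (3 * (K + 1))) (by positivity)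
  have ht : ∀ᶠ i in l, ∀ y ∈ t, ‖f i y - G y‖ < ε / 3 :=
    (eventually_all_finite htf).2 fun y hy => by
      have := (hG y (hts hy)).eventually (ball_mem_nhds _ (by positivity : 0 < ε / 3))
      simpa only [mem_ball, dist_eq_norm] using this
  filter_upwards [hf, ht] with i hi hit x hx
  obtain ⟨y, hy, hxy⟩ := mem_iUnion₂.1 (hcov hx)
  have hsmall : K * ‖x - y‖ ≤ ε / 3 := by
    have h1 : ‖x - y‖ < ε / (3 * (K + 1)) := by simpa [dist_eq_norm] using hxy
    calc K * ‖x - y‖ ≤ (K + 1) * (ε / (3 * (K + 1))) := by gcongr; linarith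
      _ = ε / 3 := by field_simp
  have h1 := hi x hx y (hts hy)
  have h2 := hGK x hx y (hts hy)
  have h3 := hit y hy
  rw [dist_eq_norm]
  have h4 : ‖G x - f i x‖ ≤ ‖G x - G y‖ + ‖f i y - G y‖ + ‖f i x - f i y‖ := by
    rw [← norm_neg (f i y - G y), ← norm_neg (f i x - f i y)]
    refine (congrArg norm ?_).trans_le norm_add₃_le
    ring
  linarith

theorem norm_sub_le_of_norm_le_on_ball {f : ℂ → ℂ} {M ρ ρ' : ℝ} (hρ : ρ' < ρ)
    (hf : DifferentiableOn ℂ f (ball 0 ρ)) (hM : ∀ c ∈ ball (0 : ℂ) ρ, ‖f c‖ ≤ M) :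
    ∀ x ∈ closedBall (0 : ℂ) ρ', ∀ y ∈ closedBall (0 : ℂ) ρ',
      ‖f x - f y‖ ≤ M / ((ρ - ρ') / 2) * ‖x - y‖ := by
  have hpos : 0 < (ρ - ρ') / 2 := by linarith
  have hsub : ∀ x ∈ closedBall (0 : ℂ) ρ', closedBall x ((ρ - ρ') / 2) ⊆ ball 0 ρ :=
    fun x hx => closedBall_subset_ball' (by
      have := mem_closedBall.1 hx
      linarith)
  intro x hx y hy
  refine (convex_closedBall (0 : ℂ) ρ').norm_image_sub_le_of_norm_deriv_le
    (fun w hw => hf.differentiableAt (isOpen_ball.mem_nhds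
      (hsub w hw (mem_closedBall_self hpos.le)))) (fun w hw => ?_) hy hx
  refine Complex.norm_deriv_le_of_forall_mem_sphere_norm_le hpos
    (DifferentiableOn.diffContOnCl_ball hf (hsub w hw))
    fun z hz => hM z (hsub w hw (sphere_subset_closedBall hz))

/-- A form of Montel's theorem along an ultrafilter. -/
theorem exists_differentiableOn_ultrafilter_limit {ι : Type*} {l : Ultrafilter ι} {f : ι → ℂ → ℂ}
    (hf : ∀ ρ : ℝ, 0 < ρ → ρ < 1 → ∃ M : ℝ, ∀ᶠ i in l,
      DifferentiableOn ℂ (f i) (ball 0 ρ) ∧ ∀ c ∈ ball (0 : ℂ) ρ, ‖f i c‖ ≤ M) :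
    ∃ G : ℂ → ℂ, DifferentiableOn ℂ G (ball 0 1) ∧
      ∀ c ∈ ball (0 : ℂ) 1, Tendsto (fun i => f i c) l (𝓝 (G c)) := by
  have hradius : ∀ c ∈ ball (0 : ℂ) 1, ∃ ρ : ℝ, 0 < ρ ∧ ρ < 1 ∧ c ∈ ball (0 : ℂ) ρ :=
    fun c hc => by
      obtain ⟨ρ, h1, h2⟩ := exists_between (mem_ball_zero_iff.1 hc)
      exact ⟨ρ, (norm_nonneg c).trans_lt h1, h2, mem_ball_zero_iff.2 h1⟩
  have hlim : ∀ c ∈ ball (0 : ℂ) 1, ∃ y, Tendsto (fun i => f i c) l (𝓝 y) := fun c hc => by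
    obtain ⟨ρ, hρ, hρ1, hcρ⟩ := hradius c hc
    obtain ⟨M, hM⟩ := hf ρ hρ hρ1
    have hmem : closedBall (0 : ℂ) M ∈ (l.map fun i => f i c) :=
      hM.mono fun i hi => mem_closedBall_zero_iff.2 (hi.2 c hcρ)
    obtain ⟨y, -, hy⟩ := (isCompact_closedBall (0 : ℂ) M).ultrafilter_le_nhds' _ hmem
    exact ⟨y, hy⟩
  choose! G hG using hlim
  refine ⟨G, fun c hc => ?_, hG⟩
  obtain ⟨ρ', hρ', hρ'1, hcρ'⟩ := hradius c hc
  obtain ⟨ρ, hρ, hρ1⟩ := exists_between hρ'1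
  obtain ⟨M, hM⟩ := hf ρ (hρ'.trans hρ) hρ1
  have hM0 : 0 ≤ M := by
    obtain ⟨i, hi⟩ := hM.exists
    exact (norm_nonneg _).trans (hi.2 0 (mem_ball_self (hρ'.trans hρ)))
  have hu : TendstoUniformlyOn f G l (closedBall 0 ρ') :=
    tendstoUniformlyOn_of_eventually_lipschitz (isCompact_closedBall 0 ρ')
      (K := M / ((ρ - ρ') / 2)) (div_nonneg hM0 (by linarith))
      (hM.mono fun i hi => norm_sub_le_of_norm_le_on_ball hρ hi.1 hi.2)
      fun x hx => hG x (closedBall_subset_ball hρ'1 hx)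
  have hd : DifferentiableOn ℂ G (ball 0 ρ') :=
    (hu.mono ball_subset_closedBall).tendstoLocallyUniformlyOn.differentiableOn
      (hM.mono fun i hi => hi.1.mono (ball_subset_ball hρ.le)) isOpen_ball
  exact (hd.differentiableAt (isOpen_ball.mem_nhds hcρ')).differentiableWithinAt

namespace IsHolomorphicMotion

theorem mono {r r' : ℝ} {E : Set ℂ} {E' : Set ℂ} {h : ℂ → ℂ → ℂ} (hmot : IsHolomorphicMotion r E h)
    (hr : r' ≤ r) (hE : E' ⊆ E) : IsHolomorphicMotion r' E' h :=
  ⟨fun z hz => hmot.1 z (hE hz), fun c hc => (hmot.2.1 c (ball_subset_ball hr hc)).mono hE,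
    fun z hz => (hmot.2.2 z (hE hz)).mono (ball_subset_ball hr)⟩

theorem exists_norm_sub_le_mul_norm_sub {a b d : ℂ} (hbd : b ≠ d) {ρ ρ' : ℝ} (hρ : 0 < ρ)
    (hρ' : ρ' < ρ) :
    ∃ M : ℝ, ∀ H, IsHolomorphicMotion ρ univ H → ∀ c ∈ closedBall (0 : ℂ) ρ',
      ‖H c a - H c b‖ ≤ M * ‖H c d - H c b‖ := by
  rcases eq_or_ne a b with rfl | hab
  · exact ⟨0, fun H _ c _ => by simp⟩
  rcases eq_or_ne a d with rfl | had
  · exact ⟨1, fun H _ c _ => by simp⟩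
  obtain ⟨M, hM⟩ := schottky (a := (a - b) / (d - b)) hρ hρ'
  refine ⟨M, fun H hH c hc => ?_⟩
  have hne : ∀ {z w : ℂ}, z ≠ w → ∀ c ∈ ball (0 : ℂ) ρ, H c z - H c w ≠ 0 :=
    fun {z w} hzw c hc h =>
      hzw (hH.2.1 c hc (mem_univ z) (mem_univ w) (sub_eq_zero.1 h))
  have hd : ∀ z w : ℂ, DifferentiableOn ℂ (fun c => H c z - H c w) (ball 0 ρ) := fun z w =>
    (hH.2.2 z (mem_univ z)).sub (hH.2.2 w (mem_univ w))
  have h := hM (fun c => (H c a - H c b) / (H c d - H c b))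
    ((hd a b).div (hd d b) (hne hbd.symm))
    (fun c hc => div_ne_zero (hne hab c hc) (hne hbd.symm c hc))
    (fun c hc h1 => hne had c hc (by
      rw [div_eq_one_iff_eq (hne hbd.symm c hc)] at h1
      linear_combination h1))
    (by simp only [hH.1 _ (mem_univ _)]) c hc
  rwa [norm_div, div_le_iff₀ (norm_pos_iff.2
    (hne hbd.symm c (closedBall_subset_ball hρ' hc)))] at h

theorem exists_ultrafilter_limit {ι : Type*} {l : Ultrafilter ι} {H : ι → ℂ → ℂ → ℂ}
    {E : Set ℂ} {h : ℂ → ℂ → ℂ} (hmot : IsHolomorphicMotion 1 E h) (hE : E.Nontrivial)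
    (hH : ∀ ρ : ℝ, 0 < ρ → ρ < 1 → ∀ᶠ i in l, IsHolomorphicMotion ρ univ (H i))
    (hHh : ∀ ρ : ℝ, 0 < ρ → ρ < 1 → ∀ z ∈ E, ∀ᶠ i in l, ∀ c ∈ ball (0 : ℂ) ρ, H i c z = h c z) :
    ∃ G : ℂ → ℂ → ℂ, IsHolomorphicMotion 1 univ G ∧
      ∀ c ∈ ball (0 : ℂ) 1, ∀ z ∈ E, G c z = h c z := by
  obtain ⟨e₀, he₀, e₁, he₁, hne⟩ := hE
  have hlim : ∀ z, ∃ G : ℂ → ℂ, DifferentiableOn ℂ G (ball 0 1) ∧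
      ∀ c ∈ ball (0 : ℂ) 1, Tendsto (fun i => H i c z) l (𝓝 (G c)) := fun z => by
    refine exists_differentiableOn_ultrafilter_limit (f := fun i c => H i c z)
      fun ρ' hρ' hρ'1 => ?_
    obtain ⟨ρ, hρ, hρ1⟩ := exists_between hρ'1
    obtain ⟨M, hM⟩ := exists_norm_sub_le_mul_norm_sub (a := z) hne (hρ'.trans hρ) hρ
    have hcont : ContinuousOn (fun c => ‖h c e₀‖ + M * ‖h c e₁ - h c e₀‖) (closedBall 0 ρ') := by
      have h0 := (hmot.2.2 e₀ he₀).continuousOn.mono (closedBall_subset_ball hρ'1)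
      have h1 := (hmot.2.2 e₁ he₁).continuousOn.mono (closedBall_subset_ball hρ'1)
      exact h0.norm.add (continuousOn_const.mul (h1.sub h0).norm)
    obtain ⟨B, hB⟩ := (isCompact_closedBall (0 : ℂ) ρ').exists_bound_of_continuousOn hcont
    refine ⟨B, ?_⟩
    filter_upwards [hH ρ (hρ'.trans hρ) hρ1, hHh ρ (hρ'.trans hρ) hρ1 e₀ he₀,
      hHh ρ (hρ'.trans hρ) hρ1 e₁ he₁] with i hi hi0 hi1
    refine ⟨(hi.2.2 z (mem_univ z)).mono (ball_subset_ball hρ.le), fun c hc => ?_⟩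
    have hcρ := ball_subset_ball hρ.le hc
    have h1 := hM (H i) hi c (ball_subset_closedBall hc)
    rw [hi0 c hcρ, hi1 c hcρ] at h1
    have h2 := norm_le_norm_add_norm_sub' (H i c z) (h c e₀)
    have h3 := (le_abs_self _).trans (hB c (ball_subset_closedBall hc))
    linarith
  choose G hGd hG using hlim
  have hGh : ∀ c ∈ ball (0 : ℂ) 1, ∀ z ∈ E, G z c = h c z := fun c hc z hz => by
    obtain ⟨ρ, hcρ, hρ1⟩ := exists_between (mem_ball_zero_iff.1 hc)
    refine tendsto_nhds_unique (hG z c hc) (tendsto_const_nhds.congr' ?_)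
    filter_upwards [hHh ρ ((norm_nonneg c).trans_lt hcρ) hρ1 z hz] with i hi
    exact (hi c (mem_ball_zero_iff.2 hcρ)).symm
  refine ⟨fun c z => G z c, ⟨fun z _ => ?_, fun c hc z _ w _ hzw => ?_, fun z _ => hGd z⟩, hGh⟩
  · refine tendsto_nhds_unique (hG z 0 (mem_ball_self one_pos)) (tendsto_const_nhds.congr' ?_)
    filter_upwards [hH (1 / 2) (by norm_num) (by norm_num)] with i hi
    exact (hi.1 z (mem_univ z)).symm
  · by_contra hzw'
    obtain ⟨ρ', hcρ', hρ'1⟩ := exists_between (mem_ball_zero_iff.1 hc)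
    obtain ⟨ρ, hρ, hρ1⟩ := exists_between hρ'1
    have hρ0 : 0 < ρ := ((norm_nonneg c).trans_lt hcρ').trans hρ
    have hcoll : ∀ a, G a c = G z c := fun a => by
      obtain ⟨M, hM⟩ := exists_norm_sub_le_mul_norm_sub (a := a) hzw' hρ0 hρ
      have := le_of_tendsto_of_tendsto ((hG a c hc).sub (hG z c hc)).norm
        (((hG w c hc).sub (hG z c hc)).norm.const_mul M)
        ((hH ρ hρ0 hρ1).mono fun i hi => hM (H i) hi c (mem_closedBall_zero_iff.2 hcρ'.le))
      simp only at hzw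
      rw [hzw, sub_self, norm_zero, mul_zero, norm_le_zero_iff, ← hzw] at this
      exact sub_eq_zero.1 this
    exact hne (hmot.2.1 c hc he₀ he₁ (by
      simp only
      rw [← hGh c hc e₀ he₀, ← hGh c hc e₁ he₁, hcoll e₀, hcoll e₁]))

theorem exists_extension_of_nontrivial {E : Set ℂ} {h : ℂ → ℂ → ℂ}
    (hmot : IsHolomorphicMotion 1 E h) (hE : E.Nontrivial) :
    ∃ H : ℂ → ℂ → ℂ, IsHolomorphicMotion 1 univ H ∧
      ∀ c ∈ ball (0 : ℂ) 1, ∀ z ∈ E, H c z = h c z := by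
  have hfin : ∀ i : Finset E × Ioo (0 : ℝ) 1, ∃ H : ℂ → ℂ → ℂ, IsHolomorphicMotion i.2 univ H ∧
      ∀ c ∈ ball (0 : ℂ) i.2, ∀ z ∈ i.1, H c z = h c z := fun i => by
    obtain ⟨H, hH, hHh⟩ := (hmot.mono le_rfl (E' := (i.1.map (Function.Embedding.subtype _) :
      Finset ℂ)) fun z hz => by
        obtain ⟨w, -, rfl⟩ := Finset.mem_map.1 hz
        exact w.2).exists_extension_finset i.2.2.1 i.2.2.2
    exact ⟨H, hH, fun c hc z hz => hHh c hc z (Finset.mem_map_of_mem _ hz)⟩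
  choose H hH hHh using hfin
  have : Nonempty (Ioo (0 : ℝ) 1) := ⟨⟨1 / 2, by norm_num, by norm_num⟩⟩
  refine exists_ultrafilter_limit (l := Ultrafilter.of atTop) (H := H) hmot hE
    (fun ρ hρ hρ1 => ?_) fun ρ hρ hρ1 z hz => ?_
  · filter_upwards [Ultrafilter.of_le atTop (eventually_ge_atTop (∅, ⟨ρ, hρ, hρ1⟩))] with i hi
    exact (hH i).mono hi.2 Subset.rfl
  · filter_upwards [Ultrafilter.of_le atTop
      (eventually_ge_atTop ({⟨z, hz⟩}, ⟨ρ, hρ, hρ1⟩))] with i hi c hc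
    exact hHh i c (ball_subset_ball hi.2 hc) ⟨z, hz⟩ (hi.1 (Finset.mem_singleton_self _))

end IsHolomorphicMotion

end

/-- Slodkowski's theorem, planar form: every holomorphic motion of any
subset `E ⊆ ℂ` parametrized by the unit disk with base point `0` extends to a
holomorphic motion of the whole complex plane parametrized by the unit disk. -/
theorem slodkowski_extension
    (E : Set ℂ) (h : ℂ → ℂ → ℂ) (hmot : IsHolomorphicMotion 1 E h) :
    ∃ H : ℂ → ℂ → ℂ, IsHolomorphicMotion 1 Set.univ H ∧
      ∀ c ∈ Metric.ball (0 : ℂ) 1, ∀ z ∈ E, H c z = h c z := by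
  rcases E.subsingleton_or_nontrivial with hE | hE
  · rcases hE.eq_empty_or_singleton with rfl | ⟨e, rfl⟩
    · exact ⟨fun _ z => z, ⟨fun _ _ => rfl, fun _ _ => Set.injOn_id _,
        fun z _ => differentiableOn_const z⟩, fun _ _ z hz => hz.elim⟩
    · refine ⟨fun c z => z + (h c e - e), ⟨fun z _ => ?_, fun c _ z _ w _ hzw => ?_,
        fun z _ => ((hmot.2.2 e rfl).sub_const e).const_add z⟩, ?_⟩
      · simp [hmot.1 e rfl]
      · exact add_right_cancel hzw
      · rintro c - z rfl
        ring
  · exact hmot.exists_extension_of_nontrivial hE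
end

section
/- For every R > 0 there exists a constant C > 0 such that for every δ with 0 < δ < 1/2 and all z₁, z₂ ∈ ℂ with |z₁| < R, |z₂| < R and 0 < |z₂ − z₁| < δ, the tangent vector field V satisfies |V(z₂) − V(z₁)| ≤ |z₂ − z₁| (2 + C / log(1/δ)) log(1/|z₂ − z₁|). -/
open Filter Topology Metric Complex ComplexConjugate

lemma exists_differentiableOn_exp_eq {ρ : ℝ} (hρ : 0 < ρ) {f : ℂ → ℂ}
    (hf : DifferentiableOn ℂ f (ball 0 ρ)) (h0 : ∀ z ∈ ball (0 : ℂ) ρ, f z ≠ 0) :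
    ∃ g : ℂ → ℂ, DifferentiableOn ℂ g (ball 0 ρ) ∧
      ∀ z ∈ ball (0 : ℂ) ρ, Complex.exp (g z) = f z := by
  have hd : DifferentiableOn ℂ (fun z => deriv f z / f z) (ball 0 ρ) :=
    (hf.deriv isOpen_ball).div hf h0
  obtain ⟨g, hg0, hg⟩ := hd.isExactOn_ball.with_val_at 0 (Complex.log (f 0))
  have hgd : DifferentiableOn ℂ g (ball 0 ρ) := fun z hz =>
    (hg z hz).differentiableAt.differentiableWithinAt
  have h00 : (0 : ℂ) ∈ ball (0 : ℂ) ρ := mem_ball_self hρ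
  refine ⟨g, hgd, fun z hz => ?_⟩
  have hder : ∀ w ∈ ball (0 : ℂ) ρ, HasDerivAt (fun z => f z * Complex.exp (-g z)) 0 w := by
    intro w hw
    have h1 := (hf.differentiableAt (isOpen_ball.mem_nhds hw)).hasDerivAt
    refine (h1.fun_mul (hg w hw).fun_neg.cexp).congr_deriv ?_
    have := h0 w hw
    field_simp
    ring
  have hc := isOpen_ball.is_const_of_deriv_eq_zero (convex_ball (0 : ℂ) ρ).isPreconnected
    (fun w hw => (hder w hw).differentiableAt.differentiableWithinAt)
    (fun w hw => (hder w hw).deriv) hz h00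
  simp only [hg0, Complex.exp_neg, Complex.exp_log (h0 0 h00), mul_inv_cancel₀ (h0 0 h00)] at hc
  have := Complex.exp_ne_zero (g z)
  field_simp at hc
  exact hc.symm

lemma not_isLocalMax_norm_mul {Q : ℂ → ℂ} {E : ℂ → ℝ} {z₀ : ℂ}
    (hQ : ∀ᶠ z in 𝓝 z₀, DifferentiableAt ℂ Q z) (hQ0 : Q z₀ ≠ 0) (hE0 : 0 < E z₀)
    (hE : ∀ᶠ z in 𝓝[≠] z₀, E z₀ < E z) : ¬ IsLocalMax (fun z => ‖Q z‖ * E z) z₀ := by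
  intro hmax
  have hlt : ∀ᶠ z in 𝓝[≠] z₀, ‖Q z‖ < ‖Q z₀‖ := by
    filter_upwards [hE, hmax.filter_mono nhdsWithin_le_nhds] with z h1 h2
    have hq : 0 < ‖Q z₀‖ := norm_pos_iff.mpr hQ0
    by_contra! h
    have := mul_lt_mul' h h1 hE0.le (hq.trans_le h)
    linarith
  have hloc : IsLocalMax (norm ∘ Q) z₀ := by
    rw [eventually_nhdsWithin_iff] at hlt
    filter_upwards [hlt] with z hz
    by_cases h : z = z₀
    · rw [h]
    · exact (hz h).le
  have heq := (Complex.norm_eventually_eq_of_isLocalMax hQ hloc).filter_mono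
    (nhdsWithin_le_nhds (s := {z₀}ᶜ))
  obtain ⟨z, h1, h2⟩ := (hlt.and heq).exists
  exact h1.ne h2

lemma tendsto_norm_sq_div {φ : ℂ → ℂ} {z₀ p : ℂ} (h : HasDerivAt φ p z₀) (h0 : φ z₀ = 0) :
    Tendsto (fun z => ‖φ z‖ ^ 2 / ‖z - z₀‖ ^ 2) (𝓝[≠] z₀) (𝓝 (‖p‖ ^ 2)) := by
  refine (h.tendsto_slope.norm.pow 2).congr fun z => ?_
  rw [slope_def_field, h0, sub_zero, norm_div, div_pow]

lemma eventually_one_lt_spherical {φ ψ τ : ℂ → ℂ} {z₀ p q t : ℂ} (hφ : HasDerivAt φ p z₀)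
    (hψ : HasDerivAt ψ q z₀) (hτ : HasDerivAt τ t z₀) (hφ0 : φ z₀ = 0) (hψ0 : ψ z₀ = 0)
    (hτ0 : τ z₀ = 0) (h : 2 * ‖t‖ ^ 2 < ‖p‖ ^ 2 + ‖q‖ ^ 2) :
    ∀ᶠ z in 𝓝[≠] z₀, 1 < (1 + ‖φ z‖ ^ 2) * (1 + ‖ψ z‖ ^ 2) * (1 - ‖τ z‖ ^ 2) ^ 2 := by
  have cφ : Tendsto (fun z => ‖φ z‖ ^ 2) (𝓝[≠] z₀) (𝓝 0) := by
    simpa [hφ0] using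
      ((hφ.continuousAt.tendsto.norm.pow 2).mono_left nhdsWithin_le_nhds : Tendsto _ (𝓝[≠] z₀) _)
  have cψ : Tendsto (fun z => ‖ψ z‖ ^ 2) (𝓝[≠] z₀) (𝓝 0) := by
    simpa [hψ0] using
      ((hψ.continuousAt.tendsto.norm.pow 2).mono_left nhdsWithin_le_nhds : Tendsto _ (𝓝[≠] z₀) _)
  have key := ((tendsto_norm_sq_div hφ hφ0).add (tendsto_norm_sq_div hψ hψ0)).sub
    (((tendsto_norm_sq_div hτ hτ0).const_mul 2).mul ((cφ.const_add 1).add cψ))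
  have hpos : 0 < ‖p‖ ^ 2 + ‖q‖ ^ 2 - 2 * ‖t‖ ^ 2 * (1 + 0 + 0) := by linarith
  filter_upwards [key.eventually (lt_mem_nhds hpos), self_mem_nhdsWithin] with z hz hne
  have hd : 0 < ‖z - z₀‖ ^ 2 := by
    have := norm_pos_iff.mpr (sub_ne_zero.mpr hne)
    positivity
  have h2 : 0 < ‖φ z‖ ^ 2 + ‖ψ z‖ ^ 2 - 2 * ‖τ z‖ ^ 2 * (1 + ‖φ z‖ ^ 2 + ‖ψ z‖ ^ 2) := by
    refine (mul_pos hd hz).trans_eq ?_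
    rw [mul_sub, mul_add, mul_div_cancel₀ _ hd.ne', mul_div_cancel₀ _ hd.ne',
      ← mul_assoc, mul_left_comm, mul_div_cancel₀ _ hd.ne']
  have ha := sq_nonneg ‖φ z‖
  have hb := sq_nonneg ‖ψ z‖
  generalize ‖φ z‖ ^ 2 = a at *
  generalize ‖ψ z‖ ^ 2 = b at *
  generalize ‖τ z‖ ^ 2 = c at *
  nlinarith [mul_nonneg (mul_nonneg ha hb) (sq_nonneg (1 - c)),
    mul_nonneg (add_nonneg ha hb) (sq_nonneg c), sq_nonneg c]

lemma eventually_one_lt_hyperbolic {φ τ : ℂ → ℂ} {z₀ p t : ℂ} (hφ : HasDerivAt φ p z₀)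
    (hτ : HasDerivAt τ t z₀) (hφ0 : φ z₀ = 0) (hτ0 : τ z₀ = 0) (h : ‖t‖ < ‖p‖) :
    ∀ᶠ z in 𝓝[≠] z₀, 1 < (1 - ‖τ z‖ ^ 2) / (1 - ‖φ z‖ ^ 2) := by
  have cφ : Tendsto (fun z => ‖φ z‖ ^ 2) (𝓝[≠] z₀) (𝓝 0) := by
    simpa [hφ0] using
      ((hφ.continuousAt.tendsto.norm.pow 2).mono_left nhdsWithin_le_nhds : Tendsto _ (𝓝[≠] z₀) _)
  have key := (tendsto_norm_sq_div hτ hτ0).eventually_lt (tendsto_norm_sq_div hφ hφ0)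
    (by gcongr)
  filter_upwards [key, self_mem_nhdsWithin, cφ.eventually (gt_mem_nhds one_pos)] with z hz hne h1
  have hd : 0 < ‖z - z₀‖ ^ 2 := by
    have := norm_pos_iff.mpr (sub_ne_zero.mpr hne)
    positivity
  rw [div_lt_div_iff_of_pos_right hd] at hz
  rw [one_lt_div (by linarith)]
  linarith

lemma one_sub_norm_sq_moebius {z w : ℂ} (h : 1 - conj w * z ≠ 0) :
    ‖1 - conj w * z‖ ^ 2 * (1 - ‖(z - w) / (1 - conj w * z)‖ ^ 2) =
      (1 - ‖z‖ ^ 2) * (1 - ‖w‖ ^ 2) := by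
  have h' := norm_ne_zero_iff.mpr h
  rw [norm_div, div_pow, mul_sub, mul_div_cancel₀ _ (pow_ne_zero 2 h')]
  simp only [Complex.sq_norm, Complex.normSq_apply]
  simp
  ring

lemma one_add_norm_sq_moebius {z w : ℂ} (h : 1 + conj w * z ≠ 0) :
    ‖1 + conj w * z‖ ^ 2 * (1 + ‖(z - w) / (1 + conj w * z)‖ ^ 2) =
      (1 + ‖z‖ ^ 2) * (1 + ‖w‖ ^ 2) := by
  have h' := norm_ne_zero_iff.mpr h
  rw [norm_div, div_pow, mul_add, mul_div_cancel₀ _ (pow_ne_zero 2 h')]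
  simp only [Complex.sq_norm, Complex.normSq_apply]
  simp
  ring

lemma four_re_mul_re_moebius {z w : ℂ} (h : z + conj w ≠ 0) :
    ‖z + conj w‖ ^ 2 * (1 - ‖(z - w) / (z + conj w)‖ ^ 2) = 4 * z.re * w.re := by
  have h' := norm_ne_zero_iff.mpr h
  rw [norm_div, div_pow, mul_sub, mul_div_cancel₀ _ (pow_ne_zero 2 h')]
  simp only [Complex.sq_norm, Complex.normSq_apply]
  simp
  ring

lemma one_sub_conj_mul_self (z : ℂ) : 1 - conj z * z = ((1 - ‖z‖ ^ 2 : ℝ) : ℂ) := by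
  rw [Complex.conj_mul']; push_cast; rfl

lemma one_add_conj_mul_self (z : ℂ) : 1 + conj z * z = ((1 + ‖z‖ ^ 2 : ℝ) : ℂ) := by
  rw [Complex.conj_mul']; push_cast; rfl

lemma one_sub_conj_mul_self_ne_zero {z : ℂ} (h : ‖z‖ < 1) : 1 - conj z * z ≠ 0 := by
  have : 0 < 1 - ‖z‖ ^ 2 := by nlinarith [norm_nonneg z]
  rw [one_sub_conj_mul_self]
  exact_mod_cast this.ne'

lemma one_add_conj_mul_self_ne_zero (z : ℂ) : 1 + conj z * z ≠ 0 := by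
  have : 0 < 1 + ‖z‖ ^ 2 := by positivity
  rw [one_add_conj_mul_self]
  exact_mod_cast this.ne'

lemma HasDerivAt.div_of_eq_zero {N D : ℂ → ℂ} {z₀ p q : ℂ} (hN : HasDerivAt N p z₀)
    (hD : HasDerivAt D q z₀) (h0 : N z₀ = 0) (hD0 : D z₀ ≠ 0) :
    HasDerivAt (fun z => N z / D z) (p / D z₀) z₀ := by
  refine (hN.fun_div hD hD0).congr_deriv ?_
  rw [h0]
  field_simp
  simp

lemma hasDerivAt_disk_moebius {z₀ : ℂ} (h : ‖z₀‖ < 1) :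
    HasDerivAt (fun z => (z - z₀) / (1 - conj z₀ * z)) (1 / (1 - conj z₀ * z₀)) z₀ :=
  ((hasDerivAt_id z₀).sub_const z₀).div_of_eq_zero
    (((hasDerivAt_id z₀).const_mul (conj z₀)).const_sub 1) (sub_self _)
    (one_sub_conj_mul_self_ne_zero h)

lemma hasDerivAt_sphere_moebius {G : ℂ → ℂ} {z₀ p : ℂ} (h : HasDerivAt G p z₀) :
    HasDerivAt (fun z => (G z - G z₀) / (1 + conj (G z₀) * G z))
      (p / (1 + conj (G z₀) * G z₀)) z₀ :=
  (h.sub_const (G z₀)).div_of_eq_zero ((h.const_mul (conj (G z₀))).const_add 1) (sub_self _)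
    (one_add_conj_mul_self_ne_zero _)

lemma norm_one_add_conj_mul_self (z : ℂ) : ‖1 + conj z * z‖ = 1 + ‖z‖ ^ 2 := by
  rw [one_add_conj_mul_self, Complex.norm_of_nonneg (by positivity)]

lemma norm_one_sub_conj_mul_self {z : ℂ} (h : ‖z‖ < 1) : ‖1 - conj z * z‖ = 1 - ‖z‖ ^ 2 := by
  rw [one_sub_conj_mul_self, Complex.norm_of_nonneg (by nlinarith [norm_nonneg z])]

lemma le_two_of_isLocalMax_spherical {G H P : ℂ → ℂ} {z₀ : ℂ} (hz : ‖z₀‖ < 1)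
    (hG : ∀ᶠ z in 𝓝 z₀, DifferentiableAt ℂ G z) (hH : ∀ᶠ z in 𝓝 z₀, DifferentiableAt ℂ H z)
    (hP : ∀ᶠ z in 𝓝 z₀, DifferentiableAt ℂ P z) (hP0 : P z₀ ≠ 0)
    (hmax : IsLocalMax
      (fun z => ‖P z‖ ^ 2 * (1 + ‖G z‖ ^ 2) * (1 + ‖H z‖ ^ 2) * (1 - ‖z‖ ^ 2) ^ 2) z₀) :
    (1 - ‖z₀‖ ^ 2) ^ 2 * (‖deriv G z₀‖ ^ 2 / (1 + ‖G z₀‖ ^ 2) ^ 2 +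
      ‖deriv H z₀‖ ^ 2 / (1 + ‖H z₀‖ ^ 2) ^ 2) ≤ 2 := by
  have hs : 0 < 1 - ‖z₀‖ ^ 2 := by nlinarith [norm_nonneg z₀]
  by_contra! hlt
  have hE := eventually_one_lt_spherical
    (hasDerivAt_sphere_moebius hG.self_of_nhds.hasDerivAt)
    (hasDerivAt_sphere_moebius hH.self_of_nhds.hasDerivAt)
    (hasDerivAt_disk_moebius hz) (by simp) (by simp) (by simp) (by
      rw [norm_div, norm_div, norm_div, norm_one_add_conj_mul_self, norm_one_add_conj_mul_self,
        norm_one_sub_conj_mul_self hz, div_pow, div_pow, div_pow, norm_one, one_pow,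
        mul_one_div, div_lt_iff₀ (by positivity)]
      linarith)
  refine not_isLocalMax_norm_mul (z₀ := z₀) (Q := fun z => P z ^ 2 *
      (1 + conj (G z₀) * G z) ^ 2 * (1 + conj (H z₀) * H z) ^ 2 * (1 - conj z₀ * z) ^ 4)
    (E := fun z => (1 + ‖(G z - G z₀) / (1 + conj (G z₀) * G z)‖ ^ 2) *
      (1 + ‖(H z - H z₀) / (1 + conj (H z₀) * H z)‖ ^ 2) *
      (1 - ‖(z - z₀) / (1 - conj z₀ * z)‖ ^ 2) ^ 2) ?_ ?_ ?_ ?_ ?_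
  · filter_upwards [hG, hH, hP] with z h1 h2 h3
    fun_prop
  · have h1 := one_add_conj_mul_self_ne_zero (G z₀)
    have h2 := one_add_conj_mul_self_ne_zero (H z₀)
    have h3 := one_sub_conj_mul_self_ne_zero hz
    positivity
  · simp
  · simpa using hE
  · have c1 : ContinuousAt (fun z => 1 + conj (G z₀) * G z) z₀ :=
      (hG.self_of_nhds.continuousAt.const_mul _).const_add _
    have c2 : ContinuousAt (fun z => 1 + conj (H z₀) * H z) z₀ :=
      (hH.self_of_nhds.continuousAt.const_mul _).const_add _
    have c3 : ContinuousAt (fun z => 1 - conj z₀ * z) z₀ := by fun_prop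
    have key : ∀ᶠ z in 𝓝 z₀, ‖P z ^ 2 * (1 + conj (G z₀) * G z) ^ 2 *
        (1 + conj (H z₀) * H z) ^ 2 * (1 - conj z₀ * z) ^ 4‖ *
        ((1 + ‖(G z - G z₀) / (1 + conj (G z₀) * G z)‖ ^ 2) *
        (1 + ‖(H z - H z₀) / (1 + conj (H z₀) * H z)‖ ^ 2) *
        (1 - ‖(z - z₀) / (1 - conj z₀ * z)‖ ^ 2) ^ 2) =
        ‖P z‖ ^ 2 * (1 + ‖G z‖ ^ 2) * (1 + ‖H z‖ ^ 2) * (1 - ‖z‖ ^ 2) ^ 2 *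
          ((1 + ‖G z₀‖ ^ 2) * (1 + ‖H z₀‖ ^ 2) * (1 - ‖z₀‖ ^ 2) ^ 2) := by
      filter_upwards [c1.eventually_ne (one_add_conj_mul_self_ne_zero _),
        c2.eventually_ne (one_add_conj_mul_self_ne_zero _),
        c3.eventually_ne (one_sub_conj_mul_self_ne_zero hz)] with z h1 h2 h3
      have e1 := one_add_norm_sq_moebius h1
      have e2 := one_add_norm_sq_moebius h2
      have e3 := one_sub_norm_sq_moebius h3
      simp only [norm_mul, norm_pow]
      calc _ = ‖P z‖ ^ 2 * (‖1 + conj (G z₀) * G z‖ ^ 2 *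
            (1 + ‖(G z - G z₀) / (1 + conj (G z₀) * G z)‖ ^ 2)) *
            (‖1 + conj (H z₀) * H z‖ ^ 2 *
            (1 + ‖(H z - H z₀) / (1 + conj (H z₀) * H z)‖ ^ 2)) *
            (‖1 - conj z₀ * z‖ ^ 2 * (1 - ‖(z - z₀) / (1 - conj z₀ * z)‖ ^ 2)) ^ 2 := by ring
        _ = _ := by rw [e1, e2, e3]; ring
    filter_upwards [hmax, key] with z hm hk
    rw [hk, key.self_of_nhds]
    gcongr

lemma le_one_of_isLocalMax_halfPlane {W P : ℂ → ℂ} {z₀ : ℂ} (hz : ‖z₀‖ < 1)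
    (hW : ∀ᶠ z in 𝓝 z₀, DifferentiableAt ℂ W z) (hP : ∀ᶠ z in 𝓝 z₀, DifferentiableAt ℂ P z)
    (hP0 : P z₀ ≠ 0) (hre : 0 < (W z₀).re)
    (hmax : IsLocalMax (fun z => ‖P z‖ * ((1 - ‖z‖ ^ 2) / (W z).re)) z₀) :
    ‖deriv W z₀‖ * (1 - ‖z₀‖ ^ 2) ≤ 2 * (W z₀).re := by
  have hs : 0 < 1 - ‖z₀‖ ^ 2 := by nlinarith [norm_nonneg z₀]
  have e0 : W z₀ + conj (W z₀) = ((2 * (W z₀).re : ℝ) : ℂ) := by rw [Complex.add_conj]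
  have hD0 : W z₀ + conj (W z₀) ≠ 0 := by
    rw [e0]
    exact_mod_cast (by positivity : 2 * (W z₀).re ≠ 0)
  have hW0 := hW.self_of_nhds.hasDerivAt
  by_contra! hlt
  have hE := eventually_one_lt_hyperbolic
    ((hW0.sub_const (W z₀)).div_of_eq_zero (hW0.add_const (conj (W z₀))) (sub_self _) hD0)
    (hasDerivAt_disk_moebius hz) (by simp) (by simp) (by
      rw [norm_div, norm_div, norm_one_sub_conj_mul_self hz, e0,
        Complex.norm_of_nonneg (by positivity), norm_one,
        div_lt_div_iff₀ hs (by positivity)]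
      linarith)
  refine not_isLocalMax_norm_mul (z₀ := z₀)
    (Q := fun z => P z * (1 - conj z₀ * z) ^ 2 / (W z + conj (W z₀)) ^ 2)
    (E := fun z => (1 - ‖(z - z₀) / (1 - conj z₀ * z)‖ ^ 2) /
      (1 - ‖(W z - W z₀) / (W z + conj (W z₀))‖ ^ 2)) ?_ ?_ ?_ ?_ ?_
  all_goals
    have c1 : ContinuousAt (fun z => W z + conj (W z₀)) z₀ := hW0.continuousAt.add_const _
    have n1 := c1.eventually_ne hD0
  · filter_upwards [hW, hP, n1] with z h1 h2 h3
    have : (W z + conj (W z₀)) ^ 2 ≠ 0 := pow_ne_zero 2 h3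
    fun_prop (disch := assumption)
  · have h3 := one_sub_conj_mul_self_ne_zero hz
    positivity
  · simp
  · simpa using hE
  · have c3 : ContinuousAt (fun z => 1 - conj z₀ * z) z₀ := by fun_prop
    have key : ∀ᶠ z in 𝓝 z₀, ‖P z * (1 - conj z₀ * z) ^ 2 / (W z + conj (W z₀)) ^ 2‖ *
        ((1 - ‖(z - z₀) / (1 - conj z₀ * z)‖ ^ 2) /
          (1 - ‖(W z - W z₀) / (W z + conj (W z₀))‖ ^ 2)) =
        ‖P z‖ * ((1 - ‖z‖ ^ 2) / (W z).re) * ((1 - ‖z₀‖ ^ 2) / (4 * (W z₀).re)) := by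
      filter_upwards [n1, c3.eventually_ne (one_sub_conj_mul_self_ne_zero hz)] with z h1 h3
      have e1 := four_re_mul_re_moebius h1
      have e3 := one_sub_norm_sq_moebius h3
      simp only [norm_mul, norm_pow, norm_div] at e1 e3 ⊢
      rw [div_mul_div_comm, e1, mul_assoc, e3]
      ring
    filter_upwards [hmax, key] with z hm hk
    rw [hk, key.self_of_nhds]
    gcongr

lemma one_add_mul_one_add_le {a b : ℝ} (ha : 0 ≤ a) (hb : 0 ≤ b) (h : 1 ≤ a ^ 3 + b ^ 3) :
    (1 + a) * (1 + b) ≤ 162 * (b ^ 5 / (1 + a) ^ 2 + a ^ 5 / (1 + b) ^ 2) := by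
  wlog hab : b ≤ a generalizing a b
  · have := this hb ha (by linarith) (le_of_not_ge hab)
    linarith
  have h1 : 1 / 2 ≤ a := by
    by_contra! hlt
    have e1 : a ^ 3 ≤ (1 / 2) ^ 3 := by gcongr
    have e2 : b ^ 3 ≤ a ^ 3 := by gcongr
    norm_num at e1
    linarith
  have h2 : (1 + a) * (1 + b) ≤ 162 * (a ^ 5 / (1 + b) ^ 2) := by
    rw [← mul_div_assoc, le_div_iff₀ (by positivity)]
    calc (1 + a) * (1 + b) * (1 + b) ^ 2 ≤ (1 + a) * (1 + a) * (1 + a) ^ 2 := by gcongr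
      _ = (1 + a) ^ 4 := by ring
      _ ≤ (3 * a) ^ 4 := by gcongr; linarith
      _ = 162 * (a ^ 4 * (1 / 2)) := by ring
      _ ≤ 162 * (a ^ 4 * a) := by gcongr
      _ = 162 * a ^ 5 := by ring
  have h3 : 0 ≤ b ^ 5 / (1 + a) ^ 2 := by positivity
  linarith

lemma pow_five_le_one_add_pow_six {x : ℝ} (hx : 0 ≤ x) : x ^ 5 ≤ 1 + x ^ 6 := by
  rcases le_total x 1 with h | h
  · have := pow_le_one₀ hx h (n := 5)
    have : 0 ≤ x ^ 6 := by positivity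
    linarith
  · have := pow_le_pow_right₀ h (show 5 ≤ 6 by norm_num)
    linarith

lemma exists_differentiableOn_pow_six_eq {ρ : ℝ} (hρ : 0 < ρ) {f : ℂ → ℂ}
    (hf : DifferentiableOn ℂ f (ball 0 ρ)) (h0 : ∀ z ∈ ball (0 : ℂ) ρ, f z ≠ 0) :
    ∃ g : ℂ → ℂ, DifferentiableOn ℂ g (ball 0 ρ) ∧ ∀ z ∈ ball (0 : ℂ) ρ, g z ^ 6 = f z := by
  obtain ⟨g, hg, hgf⟩ := exists_differentiableOn_exp_eq hρ hf h0
  refine ⟨fun z => Complex.exp (g z / 6), (hg.div_const 6).cexp, fun z hz => ?_⟩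
  rw [← Complex.exp_nat_mul, ← hgf z hz]
  congr 1
  push_cast
  ring

lemma one_sub_sq_mul_norm_deriv_le_of_omits {ρ : ℝ} (hρ : 1 < ρ) {f : ℂ → ℂ}
    (hf : DifferentiableOn ℂ f (ball 0 ρ)) (h0 : ∀ z ∈ ball (0 : ℂ) ρ, f z ≠ 0)
    (h1 : ∀ z ∈ ball (0 : ℂ) ρ, f z ≠ 1) {z : ℂ} (hz : z ∈ closedBall (0 : ℂ) 1) :
    (1 - ‖z‖ ^ 2) * ‖deriv f z‖ ≤ 108 * (1 + ‖f z‖) * (2 + ‖f z‖) := by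
  have hρ0 : 0 < ρ := by linarith
  obtain ⟨G, hG, hGf⟩ := exists_differentiableOn_pow_six_eq hρ0 hf h0
  obtain ⟨H, hH, hHf⟩ := exists_differentiableOn_pow_six_eq hρ0 (hf.sub_const 1)
    (fun z hz => sub_ne_zero.mpr (h1 z hz))
  have hsub : closedBall (0 : ℂ) 1 ⊆ ball 0 ρ := closedBall_subset_ball hρ
  have hH0 : ∀ z ∈ ball (0 : ℂ) ρ, H z ≠ 0 := fun z hz h => by
    have := hHf z hz
    rw [h, zero_pow (by norm_num)] at this
    exact h1 z hz (sub_eq_zero.mp this.symm)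
  have hG0 : ∀ z ∈ ball (0 : ℂ) ρ, G z ≠ 0 := fun z hz h => by
    have := hGf z hz
    rw [h, zero_pow (by norm_num)] at this
    exact h0 z hz this.symm
  have hfG : ∀ z ∈ ball (0 : ℂ) ρ, deriv f z = 6 * G z ^ 5 * deriv G z := fun z hz => by
    have hn := isOpen_ball.mem_nhds hz
    have := ((hG.differentiableAt hn).hasDerivAt.fun_pow 6).congr_of_eventuallyEq
      (f₁ := f) (by filter_upwards [hn] with w hw using (hGf w hw).symm)
    rw [this.deriv]
    norm_num
  have hfH : ∀ z ∈ ball (0 : ℂ) ρ, deriv f z = 6 * H z ^ 5 * deriv H z := fun z hz => by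
    have hn := isOpen_ball.mem_nhds hz
    have := (((hH.differentiableAt hn).hasDerivAt.fun_pow 6).add_const 1).congr_of_eventuallyEq
      (f₁ := f) (by
        filter_upwards [hn] with w hw
        rw [hHf w hw]
        ring)
    rw [this.deriv]
    norm_num
  set P : ℂ → ℂ := fun z => deriv G z / H z ^ 5 with hPdef
  have hP : DifferentiableOn ℂ P (ball 0 ρ) :=
    (hG.deriv isOpen_ball).div (hH.pow 5) fun z hz => pow_ne_zero 5 (hH0 z hz)
  have hGP : ∀ z ∈ ball (0 : ℂ) ρ, deriv G z = P z * H z ^ 5 := fun z hz => by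
    rw [hPdef, div_mul_cancel₀ _ (pow_ne_zero 5 (hH0 z hz))]
  have hHP : ∀ z ∈ ball (0 : ℂ) ρ, deriv H z = P z * G z ^ 5 := fun z hz => by
    have e := (hfG z hz).symm.trans (hfH z hz)
    rw [hGP z hz] at e
    have := hH0 z hz
    refine mul_left_cancel₀ (show (6 : ℂ) * H z ^ 5 ≠ 0 by simp [this]) ?_
    rw [← e]
    ring
  set u : ℂ → ℝ := fun z =>
    ‖P z‖ ^ 2 * (1 + ‖G z‖ ^ 2) * (1 + ‖H z‖ ^ 2) * (1 - ‖z‖ ^ 2) ^ 2 with hu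
  have huc : ContinuousOn u (closedBall 0 1) := by
    have c1 := (hP.mono hsub).continuousOn
    have c2 := (hG.mono hsub).continuousOn
    have c3 := (hH.mono hsub).continuousOn
    fun_prop
  obtain ⟨z₀, hz₀, hmax⟩ := (isCompact_closedBall (0 : ℂ) 1).exists_isMaxOn
    ⟨0, mem_closedBall_self zero_le_one⟩ huc
  have hbound : u z₀ ≤ 324 := by
    by_cases hP0 : P z₀ = 0
    · simp [hu, hP0]
    rcases (mem_closedBall_zero_iff.mp hz₀).eq_or_lt with hz1 | hz1
    · simp [hu, hz1]
    have hm := hsub hz₀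
    have hn := isOpen_ball.mem_nhds hm
    have hloc : IsLocalMax u z₀ := hmax.isLocalMax
      (mem_of_superset (isOpen_ball.mem_nhds (mem_ball_zero_iff.mpr hz1)) ball_subset_closedBall)
    have key := le_two_of_isLocalMax_spherical hz1 (hG.eventually_differentiableAt hn)
      (hH.eventually_differentiableAt hn) (hP.eventually_differentiableAt hn) hP0 hloc
    have ha : 0 ≤ ‖G z₀‖ ^ 2 := by positivity
    have hb : 0 ≤ ‖H z₀‖ ^ 2 := by positivity
    have hsum : 1 ≤ (‖G z₀‖ ^ 2) ^ 3 + (‖H z₀‖ ^ 2) ^ 3 := by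
      have e : G z₀ ^ 6 - H z₀ ^ 6 = 1 := by rw [hGf _ hm, hHf _ hm]; ring
      have := norm_sub_le (G z₀ ^ 6) (H z₀ ^ 6)
      rw [e, norm_one, norm_pow, norm_pow] at this
      rw [← pow_mul, ← pow_mul]
      exact this
    have hineq := one_add_mul_one_add_le ha hb hsum
    rw [hGP _ hm, hHP _ hm] at key
    simp only [norm_mul, norm_pow, mul_pow] at key
    calc u z₀ = (1 - ‖z₀‖ ^ 2) ^ 2 * ‖P z₀‖ ^ 2 * ((1 + ‖G z₀‖ ^ 2) * (1 + ‖H z₀‖ ^ 2)) := by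
          rw [hu]; ring
      _ ≤ (1 - ‖z₀‖ ^ 2) ^ 2 * ‖P z₀‖ ^ 2 * (162 * ((‖H z₀‖ ^ 2) ^ 5 / (1 + ‖G z₀‖ ^ 2) ^ 2 +
          (‖G z₀‖ ^ 2) ^ 5 / (1 + ‖H z₀‖ ^ 2) ^ 2)) := by gcongr
      _ = 162 * ((1 - ‖z₀‖ ^ 2) ^ 2 * (‖P z₀‖ ^ 2 * (‖H z₀‖ ^ 5) ^ 2 / (1 + ‖G z₀‖ ^ 2) ^ 2 +
          ‖P z₀‖ ^ 2 * (‖G z₀‖ ^ 5) ^ 2 / (1 + ‖H z₀‖ ^ 2) ^ 2)) := by ring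
      _ ≤ 324 := by linarith
  have hm := hsub hz
  have hs : 0 ≤ 1 - ‖z‖ ^ 2 := by
    nlinarith [norm_nonneg z, mem_closedBall_zero_iff.mp hz]
  have hPz : ‖P z‖ * (1 - ‖z‖ ^ 2) ≤ 18 := by
    refine le_of_sq_le_sq ?_ (by norm_num)
    calc (‖P z‖ * (1 - ‖z‖ ^ 2)) ^ 2 = ‖P z‖ ^ 2 * 1 * 1 * (1 - ‖z‖ ^ 2) ^ 2 := by ring
      _ ≤ u z := by
          simp only [hu]
          gcongr <;> nlinarith [sq_nonneg ‖G z‖, sq_nonneg ‖H z‖]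
      _ ≤ 324 := (hmax hz).trans hbound
      _ = 18 ^ 2 := by norm_num
  have hG5 : ‖G z‖ ^ 5 ≤ 1 + ‖f z‖ := by
    rw [← hGf z hm, norm_pow]
    exact pow_five_le_one_add_pow_six (norm_nonneg _)
  have hH5 : ‖H z‖ ^ 5 ≤ 2 + ‖f z‖ := by
    have e1 := pow_five_le_one_add_pow_six (norm_nonneg (H z))
    rw [← norm_pow (H z) 6, hHf z hm] at e1
    have e2 := norm_sub_le (f z) 1
    rw [norm_one] at e2
    linarith
  rw [hfG z hm, hGP z hm]
  simp only [norm_mul, norm_pow, Complex.norm_ofNat]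
  calc _ = 6 * (‖P z‖ * (1 - ‖z‖ ^ 2)) * ‖G z‖ ^ 5 * ‖H z‖ ^ 5 := by ring
    _ ≤ 6 * 18 * (1 + ‖f z‖) * (2 + ‖f z‖) := by gcongr
    _ = _ := by ring

lemma norm_deriv_zero_le_log_of_omits {ρ : ℝ} (hρ : 1 < ρ) {f : ℂ → ℂ}
    (hf : DifferentiableOn ℂ f (ball 0 ρ)) (h0 : ∀ z ∈ ball (0 : ℂ) ρ, f z ≠ 0)
    (h1 : ∀ z ∈ ball (0 : ℂ) ρ, f z ≠ 1) (hle : ‖f 0‖ ≤ 1) :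
    ‖deriv f 0‖ ≤ 2 * ‖f 0‖ * (324 - Real.log ‖f 0‖) := by
  have hρ0 : 0 < ρ := by linarith
  obtain ⟨g, hg, hgf⟩ := exists_differentiableOn_exp_eq hρ0 hf h0
  have hsub : closedBall (0 : ℂ) 1 ⊆ ball 0 ρ := closedBall_subset_ball hρ
  have hnorm : ∀ z ∈ ball (0 : ℂ) ρ, ‖f z‖ = Real.exp (g z).re := fun z hz => by
    rw [← hgf z hz, Complex.norm_exp]
  have hder : ∀ z ∈ ball (0 : ℂ) ρ, deriv f z = f z * deriv g z := fun z hz => by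
    have hn := isOpen_ball.mem_nhds hz
    have := (hg.differentiableAt hn).hasDerivAt.cexp.congr_of_eventuallyEq
      (f₁ := f) (by filter_upwards [hn] with w hw using (hgf w hw).symm)
    rw [this.deriv, hgf z hz]
  have hg' := hg.deriv isOpen_ball
  have cg := (hg.mono hsub).continuousOn
  have cg' := (hg'.mono hsub).continuousOn
  set S : Set ℂ := closedBall 0 1 ∩ {z | (g z).re ≤ 0} with hS
  have hScl : IsClosed S :=
    (Complex.continuous_re.comp_continuousOn cg).preimage_isClosed_of_isClosed
      isClosed_closedBall isClosed_Iic
  have hSc : IsCompact S := (isCompact_closedBall (0 : ℂ) 1).of_isClosed_subset hScl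
    Set.inter_subset_left
  have h00 : (0 : ℂ) ∈ ball (0 : ℂ) ρ := mem_ball_self hρ0
  have h0S : (0 : ℂ) ∈ S := by
    refine ⟨mem_closedBall_self zero_le_one, ?_⟩
    rw [hnorm 0 h00] at hle
    simpa using hle
  set u : ℂ → ℝ := fun z => ‖deriv g z‖ * ((1 - ‖z‖ ^ 2) / (324 - g z).re) with hu
  have hre : ∀ z ∈ S, 324 ≤ (324 - g z).re := fun z hz => by
    have : (g z).re ≤ 0 := hz.2
    simp
    linarith
  have huc : ContinuousOn u S := by
    have c1 := cg.mono (Set.inter_subset_left : S ⊆ _)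
    have c2 := cg'.mono (Set.inter_subset_left : S ⊆ _)
    refine c2.norm.mul (ContinuousOn.div (by fun_prop)
      (Complex.continuous_re.comp_continuousOn (continuousOn_const.sub c1)) fun z hz => ?_)
    have := hre z hz
    exact (by linarith : (0 : ℝ) < (324 - g z).re).ne'
  obtain ⟨z₀, hz₀, hmax⟩ := hSc.exists_isMaxOn ⟨0, h0S⟩ huc
  have hbound : u z₀ ≤ 2 := by
    have hre0 := hre z₀ hz₀
    have hpos : 0 < (324 - g z₀).re := by linarith
    by_cases hP0 : deriv g z₀ = 0
    · simp [hu, hP0]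
    rcases (mem_closedBall_zero_iff.mp hz₀.1).eq_or_lt with hz1 | hz1
    · simp [hu, hz1]
    have hm := hsub hz₀.1
    have hn := isOpen_ball.mem_nhds hm
    suffices ‖deriv g z₀‖ * (1 - ‖z₀‖ ^ 2) ≤ 2 * (324 - g z₀).re by
      simp only [hu]
      rwa [← mul_div_assoc, div_le_iff₀ hpos]
    rcases (show (g z₀).re ≤ 0 from hz₀.2).eq_or_lt with hr | hr
    · have crude := one_sub_sq_mul_norm_deriv_le_of_omits hρ hf h0 h1 hz₀.1
      rw [hder _ hm, norm_mul, hnorm _ hm, hr, Real.exp_zero] at crude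
      linarith
    · have hloc : IsLocalMax u z₀ := by
        refine hmax.isLocalMax ?_
        have c : ContinuousAt (fun z => (g z).re) z₀ :=
          Complex.continuous_re.continuousAt.comp (hg.differentiableAt hn).continuousAt
        filter_upwards [isOpen_ball.mem_nhds (mem_ball_zero_iff.mpr hz1),
          c.eventually (gt_mem_nhds hr)] with z h2 h3
        exact ⟨ball_subset_closedBall h2, h3.le⟩
      have := le_one_of_isLocalMax_halfPlane (W := fun z => 324 - g z) hz1
        ((hg.const_sub 324).eventually_differentiableAt hn)
        (hg'.eventually_differentiableAt hn) hP0 hpos hloc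
      rwa [deriv_const_sub, norm_neg] at this
  have hfin : u 0 ≤ 2 := (hmax h0S).trans hbound
  have hlog : Real.log ‖f 0‖ = (g 0).re := by rw [hnorm 0 h00, Real.log_exp]
  have hpos : 0 < (324 - g 0).re := by linarith [hre 0 h0S]
  simp only [hu, norm_zero] at hfin
  rw [← mul_div_assoc, div_le_iff₀ hpos] at hfin
  rw [hder 0 h00, norm_mul, hlog]
  have e : (324 - g 0).re = 324 - (g 0).re := by simp
  rw [e] at hfin
  have := mul_le_mul_of_nonneg_left hfin (norm_nonneg (f 0))
  linarith

lemma norm_deriv_zero_le_of_forall_rescale {f : ℂ → ℂ} {M : ℝ}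
    (h : ∀ r ∈ Set.Ioo (0 : ℝ) 1, ‖deriv (fun z => f (r * z)) 0‖ ≤ M) : ‖deriv f 0‖ ≤ M := by
  have ht : Tendsto (fun r : ℝ => r * ‖deriv f 0‖) (𝓝[<] 1) (𝓝 (1 * ‖deriv f 0‖)) :=
    ((continuous_id.mul continuous_const).tendsto (1 : ℝ)).mono_left nhdsWithin_le_nhds
  rw [one_mul] at ht
  refine le_of_tendsto ht ?_
  filter_upwards [Ioo_mem_nhdsLT (zero_lt_one (α := ℝ))] with r hr
  have := h r hr
  rwa [deriv_comp_mul_left, mul_zero, norm_smul, Complex.norm_of_nonneg hr.1.le] at this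

lemma mul_mem_ball_of_mem_ball_inv {r : ℝ} (hr : r ∈ Set.Ioo (0 : ℝ) 1) {z : ℂ}
    (hz : z ∈ ball (0 : ℂ) r⁻¹) : (r : ℂ) * z ∈ ball (0 : ℂ) 1 := by
  rw [mem_ball_zero_iff] at hz ⊢
  rw [norm_mul, Complex.norm_of_nonneg hr.1.le]
  calc r * ‖z‖ < r * r⁻¹ := by
        have := hr.1
        gcongr
    _ = 1 := mul_inv_cancel₀ hr.1.ne'

lemma differentiableOn_rescale {f : ℂ → ℂ} (hf : DifferentiableOn ℂ f (ball 0 1)) {r : ℝ}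
    (hr : r ∈ Set.Ioo (0 : ℝ) 1) :
    DifferentiableOn ℂ (fun z => f (r * z)) (ball 0 r⁻¹) :=
  hf.comp (by fun_prop) fun _ hz => mul_mem_ball_of_mem_ball_inv hr hz

/-- Landau's theorem, with a crude bound. -/
theorem norm_deriv_zero_le_of_omits_unitDisk {f : ℂ → ℂ} (hf : DifferentiableOn ℂ f (ball 0 1))
    (h0 : ∀ z ∈ ball (0 : ℂ) 1, f z ≠ 0) (h1 : ∀ z ∈ ball (0 : ℂ) 1, f z ≠ 1) :
    ‖deriv f 0‖ ≤ 108 * (1 + ‖f 0‖) * (2 + ‖f 0‖) := by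
  refine norm_deriv_zero_le_of_forall_rescale fun r hr => ?_
  simpa using one_sub_sq_mul_norm_deriv_le_of_omits ((one_lt_inv₀ hr.1).mpr hr.2)
    (differentiableOn_rescale hf hr) (fun z hz => h0 _ (mul_mem_ball_of_mem_ball_inv hr hz))
    (fun z hz => h1 _ (mul_mem_ball_of_mem_ball_inv hr hz)) (mem_closedBall_self zero_le_one)

/-- Landau's theorem, with the sharp leading constant as `f 0 → 0`. -/
theorem norm_deriv_zero_le_log_of_omits_unitDisk {f : ℂ → ℂ}
    (hf : DifferentiableOn ℂ f (ball 0 1)) (h0 : ∀ z ∈ ball (0 : ℂ) 1, f z ≠ 0)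
    (h1 : ∀ z ∈ ball (0 : ℂ) 1, f z ≠ 1) (hle : ‖f 0‖ ≤ 1) :
    ‖deriv f 0‖ ≤ 2 * ‖f 0‖ * (324 - Real.log ‖f 0‖) := by
  refine norm_deriv_zero_le_of_forall_rescale fun r hr => ?_
  simpa using norm_deriv_zero_le_log_of_omits ((one_lt_inv₀ hr.1).mpr hr.2)
    (differentiableOn_rescale hf hr) (fun z hz => h0 _ (mul_mem_ball_of_mem_ball_inv hr hz))
    (fun z hz => h1 _ (mul_mem_ball_of_mem_ball_inv hr hz)) (by simpa using hle)

lemma IsHolomorphicMotion.differentiableAt_zero {h : ℂ → ℂ → ℂ}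
    (hmot : IsHolomorphicMotion 1 Set.univ h) (z : ℂ) :
    DifferentiableAt ℂ (fun c => h c z) 0 :=
  (hmot.2.2 z trivial).differentiableAt (ball_mem_nhds _ one_pos)

lemma deriv_eq_zero_of_normalized {h : ℂ → ℂ → ℂ} (hnorm0 : ∀ c ∈ ball (0 : ℂ) 1, h c 0 = 0)
    (hnorm1 : ∀ c ∈ ball (0 : ℂ) 1, h c 1 = 1) {z : ℂ} (hz : z = 0 ∨ z = 1) :
    deriv (fun c => h c z) 0 = 0 := by
  have heq : (fun c => h c z) =ᶠ[𝓝 0] fun _ => z := by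
    filter_upwards [ball_mem_nhds (0 : ℂ) one_pos] with c hc
    rcases hz with rfl | rfl
    exacts [hnorm0 c hc, hnorm1 c hc]
  rw [heq.deriv_eq, deriv_const]

lemma IsHolomorphicMotion.norm_deriv_le {h : ℂ → ℂ → ℂ}
    (hmot : IsHolomorphicMotion 1 Set.univ h)
    (hnorm0 : ∀ c ∈ ball (0 : ℂ) 1, h c 0 = 0) (hnorm1 : ∀ c ∈ ball (0 : ℂ) 1, h c 1 = 1)
    (z : ℂ) : ‖deriv (fun c => h c z) 0‖ ≤ 108 * (1 + ‖z‖) * (2 + ‖z‖) := by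
  by_cases hz : z = 0 ∨ z = 1
  · rw [deriv_eq_zero_of_normalized hnorm0 hnorm1 hz, norm_zero]
    positivity
  · obtain ⟨hz0, hz1⟩ := not_or.mp hz
    have := norm_deriv_zero_le_of_omits_unitDisk (hmot.2.2 z trivial)
      (fun c hc e => hz0 (hmot.2.1 c hc trivial trivial (e.trans (hnorm0 c hc).symm)))
      (fun c hc e => hz1 (hmot.2.1 c hc trivial trivial (e.trans (hnorm1 c hc).symm)))
    rwa [hmot.1 z trivial] at this

/-- Comparison of the velocities of three points of a holomorphic motion, via the cross-ratio
of these points and `∞`. -/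
lemma IsHolomorphicMotion.norm_deriv_sub_deriv_le {h : ℂ → ℂ → ℂ}
    (hmot : IsHolomorphicMotion 1 Set.univ h) {z₁ z₂ w : ℂ} (h12 : z₂ ≠ z₁)
    (hw : ‖z₂ - z₁‖ < ‖w - z₁‖) :
    ‖deriv (fun c => h c z₂) 0 - deriv (fun c => h c z₁) 0‖ ≤
      2 * ‖z₂ - z₁‖ * (324 + Real.log ‖w - z₁‖ - Real.log ‖z₂ - z₁‖) +
      ‖z₂ - z₁‖ / ‖w - z₁‖ * ‖deriv (fun c => h c w) 0 - deriv (fun c => h c z₁) 0‖ := by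
  have hd : 0 < ‖z₂ - z₁‖ := norm_pos_iff.mpr (sub_ne_zero.mpr h12)
  have hD : 0 < ‖w - z₁‖ := hd.trans hw
  have hw1 : w ≠ z₁ := sub_ne_zero.mp (norm_pos_iff.mp hD)
  have hw2 : z₂ ≠ w := by
    rintro rfl
    exact hw.false
  have hne : ∀ c ∈ ball (0 : ℂ) 1, ∀ {x y : ℂ}, x ≠ y → h c x - h c y ≠ 0 :=
    fun c hc x y hxy => sub_ne_zero.mpr fun e => hxy (hmot.2.1 c hc trivial trivial e)
  have h00 : (0 : ℂ) ∈ ball (0 : ℂ) 1 := mem_ball_self one_pos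
  set f : ℂ → ℂ := fun c => (h c z₂ - h c z₁) / (h c w - h c z₁) with hf
  have hf0 : f 0 = (z₂ - z₁) / (w - z₁) := by
    simp only [hf, hmot.1 _ (Set.mem_univ _)]
  have hnf0 : ‖f 0‖ = ‖z₂ - z₁‖ / ‖w - z₁‖ := by rw [hf0, norm_div]
  have key := norm_deriv_zero_le_log_of_omits_unitDisk (f := f)
    (((hmot.2.2 z₂ trivial).sub (hmot.2.2 z₁ trivial)).div
      ((hmot.2.2 w trivial).sub (hmot.2.2 z₁ trivial)) fun c hc => hne c hc hw1)
    (fun c hc => div_ne_zero (hne c hc h12) (hne c hc hw1))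
    (fun c hc e => by
      rw [div_eq_one_iff_eq (hne c hc hw1)] at e
      exact hne c hc hw2 (sub_eq_zero.mpr (sub_left_inj.mp e)))
    (by rw [hnf0]; exact (div_le_one hD).mpr hw.le)
  have hder := ((hmot.differentiableAt_zero z₂).hasDerivAt.fun_sub
      (hmot.differentiableAt_zero z₁).hasDerivAt).fun_div
    ((hmot.differentiableAt_zero w).hasDerivAt.fun_sub
      (hmot.differentiableAt_zero z₁).hasDerivAt) (hne 0 h00 hw1)
  have hfd := hder.deriv
  simp only [hmot.1 _ (Set.mem_univ _)] at hfd
  have hwz : w - z₁ ≠ 0 := sub_ne_zero.mpr hw1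
  have hsplit : deriv (fun c => h c z₂) 0 - deriv (fun c => h c z₁) 0 =
      (w - z₁) * deriv f 0 +
        f 0 * (deriv (fun c => h c w) 0 - deriv (fun c => h c z₁) 0) := by
    rw [hf0, hf, hfd]
    field_simp
    ring
  rw [hnf0, Real.log_div hd.ne' hD.ne'] at key
  calc _ ≤ ‖w - z₁‖ * ‖deriv f 0‖ + ‖z₂ - z₁‖ / ‖w - z₁‖ *
        ‖deriv (fun c => h c w) 0 - deriv (fun c => h c z₁) 0‖ := by
        rw [hsplit, ← hnf0, ← norm_mul, ← norm_mul]
        exact norm_add_le _ _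
    _ ≤ ‖w - z₁‖ * (2 * (‖z₂ - z₁‖ / ‖w - z₁‖) *
          (324 - (Real.log ‖z₂ - z₁‖ - Real.log ‖w - z₁‖))) + ‖z₂ - z₁‖ / ‖w - z₁‖ *
        ‖deriv (fun c => h c w) 0 - deriv (fun c => h c z₁) 0‖ := by gcongr
    _ = _ := by
        field_simp
        ring

/-- Let `h` be a normalized holomorphic motion of `ℂ` parametrized by the
unit disk with base point `0` (fixing `0` and `1`, each time-`c` map a bijection of `ℂ`)
and let `V z = (d/dc) h(c,z)|_{c=0}` be the tangent vector field at the base point.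
For every `R > 0` there is `C > 0` such that for every `0 < δ < 1/2` and all
`z₁, z₂` with `|z₁| < R`, `|z₂| < R` and `0 < |z₂ - z₁| < δ`,
`|V(z₂) - V(z₁)| ≤ |z₂ - z₁| (2 + C / log(1/δ)) log(1/|z₂ - z₁|)`. -/
theorem tangent_vector_epsLogEps
    (h : ℂ → ℂ → ℂ) (hmot : IsHolomorphicMotion 1 Set.univ h)
    (hnorm0 : ∀ c ∈ Metric.ball (0 : ℂ) 1, h c 0 = 0)
    (hnorm1 : ∀ c ∈ Metric.ball (0 : ℂ) 1, h c 1 = 1)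
    (hbij : ∀ c ∈ Metric.ball (0 : ℂ) 1, Function.Bijective (fun z => h c z))
    (V : ℂ → ℂ) (hV : ∀ z : ℂ, V z = deriv (fun c => h c z) 0)
    (R : ℝ) (hR : 0 < R) :
    ∃ C : ℝ, 0 < C ∧
      ∀ δ : ℝ, 0 < δ → δ < 1 / 2 →
        ∀ z₁ z₂ : ℂ, ‖z₁‖ < R → ‖z₂‖ < R → 0 < ‖z₂ - z₁‖ → ‖z₂ - z₁‖ < δ →
          ‖V z₂ - V z₁‖ ≤
            ‖z₂ - z₁‖ * (2 + C / Real.log (1 / δ)) * Real.log (1 / ‖z₂ - z₁‖) := by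
  have hC : 0 < 648 + 2 * (1 + R) + 216 * (1 + R) * (2 + R) := by positivity
  refine ⟨_, hC, fun δ hδ hδ2 z₁ z₂ hz₁ hz₂ hd hdδ => ?_⟩
  generalize hCdef : 648 + 2 * (1 + R) + 216 * (1 + R) * (2 + R) = C at hC ⊢
  obtain ⟨w, hw01, hw⟩ : ∃ w : ℂ, (w = 0 ∨ w = 1) ∧ 1 / 2 ≤ ‖w - z₁‖ := by
    by_contra! hcon
    have e0 := hcon 0 (Or.inl rfl)
    have e1 := hcon 1 (Or.inr rfl)
    have := norm_sub_le (1 - z₁) (0 - z₁)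
    rw [sub_sub_sub_cancel_right, sub_zero, norm_one] at this
    linarith
  have hwR : ‖w - z₁‖ ≤ 1 + R := by
    have h1 : ‖w‖ ≤ 1 := by rcases hw01 with rfl | rfl <;> simp
    have := norm_sub_le w z₁
    linarith
  have key := hmot.norm_deriv_sub_deriv_le (sub_ne_zero.mp (norm_pos_iff.mp hd))
    (show ‖z₂ - z₁‖ < ‖w - z₁‖ by linarith)
  have hV1 : ‖deriv (fun c => h c z₁) 0‖ ≤ 108 * (1 + R) * (2 + R) := by
    refine (hmot.norm_deriv_le hnorm0 hnorm1 z₁).trans ?_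
    gcongr
  rw [deriv_eq_zero_of_normalized hnorm0 hnorm1 hw01, zero_sub, norm_neg, ← hV, ← hV] at key
  rw [← hV] at hV1
  have hlogD : Real.log ‖w - z₁‖ ≤ 1 + R :=
    (Real.log_le_self (norm_nonneg _)).trans hwR
  have hratio : ‖z₂ - z₁‖ / ‖w - z₁‖ ≤ 2 * ‖z₂ - z₁‖ := by
    rw [div_le_iff₀ (by linarith)]
    nlinarith
  have hl : 0 < Real.log (1 / δ) := Real.log_pos (by rw [lt_div_iff₀ hδ]; linarith)
  have hlL : Real.log (1 / δ) ≤ Real.log (1 / ‖z₂ - z₁‖) :=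
    Real.log_le_log (by positivity) (by gcongr)
  have hL : Real.log (1 / ‖z₂ - z₁‖) = -Real.log ‖z₂ - z₁‖ := by
    rw [one_div, Real.log_inv]
  have hCL : C ≤ C / Real.log (1 / δ) * Real.log (1 / ‖z₂ - z₁‖) := by
    rw [div_mul_eq_mul_div, le_div_iff₀ hl]
    gcongr
  calc ‖V z₂ - V z₁‖
      ≤ 2 * ‖z₂ - z₁‖ * (324 + (1 + R) - Real.log ‖z₂ - z₁‖) +
        2 * ‖z₂ - z₁‖ * (108 * (1 + R) * (2 + R)) := by
        refine key.trans ?_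
        gcongr
    _ = ‖z₂ - z₁‖ * (2 * Real.log (1 / ‖z₂ - z₁‖) + C) := by
        rw [hL, ← hCdef]
        ring
    _ ≤ ‖z₂ - z₁‖ * (2 * Real.log (1 / ‖z₂ - z₁‖) +
          C / Real.log (1 / δ) * Real.log (1 / ‖z₂ - z₁‖)) := by gcongr
    _ = _ := by ring
end
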